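/- arXiv:1604.00797 — 4 statements merged into one kernel-verified Lean document; each statement's English description precedes it below -/
import Mathlib

section
/- Let R be a ring and M a pure projective right R-module. Then the class M^{⊥₁} = {X : Ext¹_R(M, X) = 0} is closed under pure submodules: if 0 → Y → X → X/Y → 0 is a pure exact sequence and Ext¹_R(M, X) = 0, then Ext¹_R(M, Y) = 0. -/
open CategoryTheory Limits DirectSum

universe u

noncomputable section

/-- `Ext^n_R(M, X) = 0`, via the `Ext` bifunctor on the abelian category of `R`-modules. -/
def ExtVanish (R : Type u) [Ring R] (n : ℕ) (M X : ModuleCat.{u} R) : Prop :=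
  Subsingleton (((Ext ℤ (ModuleCat.{u} R) n).obj (Opposite.op M)).obj X)

/-- A module `M` is pure projective if it is a direct summand of a direct sum of
finitely presented modules. -/
def IsPureProjective (R : Type u) [Ring R] (M : Type u) [AddCommGroup M] [Module R M] :
    Prop :=
  ∃ (ι : Type u) (F : ι → ModuleCat.{u} R),
    (∀ i, Module.FinitePresentation R (F i)) ∧
    ∃ (s : M →ₗ[R] (⨁ i, F i)) (r : (⨁ i, F i) →ₗ[R] M), r ∘ₗ s = LinearMap.id

/-- A submodule `Y ≤ X` is pure if every finitely presented module has the lifting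
property with respect to the projection `X → X/Y` (equivalently, the inclusion stays
injective after tensoring by any module). -/
def IsPureSubmodule (R : Type u) [Ring R] (X : Type u) [AddCommGroup X] [Module R X]
    (Y : Submodule R X) : Prop :=
  ∀ (F : Type u) [AddCommGroup F] [Module R F], Module.FinitePresentation R F →
    ∀ g : F →ₗ[R] (X ⧸ Y), ∃ h : F →ₗ[R] X, Y.mkQ ∘ₗ h = g

/-- The trace of `T` in `N`: the sum of the images of all homomorphisms `T → N`. -/
def traceSub (R : Type u) [Ring R] (T : Type u) [AddCommGroup T] [Module R T]
    (N : Type u) [AddCommGroup N] [Module R N] : Submodule R N :=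
  ⨆ f : T →ₗ[R] N, LinearMap.range f

/-- `M` belongs to `Add T`: it is a direct summand of a direct sum of copies of `T`. -/
def MemAddT (R : Type u) [Ring R] (T : Type u) [AddCommGroup T] [Module R T]
    (M : Type u) [AddCommGroup M] [Module R M] : Prop :=
  ∃ (κ : Type u) (s : M →ₗ[R] (κ →₀ T)) (p : (κ →₀ T) →ₗ[R] M), p ∘ₗ s = LinearMap.id

/-- `X` belongs to the class `T^⊥`, i.e. `Ext^i_R(T, X) = 0` for all `i ≥ 1`. -/
def InTPerp (R : Type u) [Ring R] (T : Type u) [AddCommGroup T] [Module R T]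
    (X : ModuleCat.{u} R) : Prop :=
  ∀ i : ℕ, 1 ≤ i → ExtVanish R i (ModuleCat.of R T) X

/-- A class of modules is closed under direct limits. -/
def ClosedUnderDirectLimits (R : Type u) [Ring R] (P : ModuleCat.{u} R → Prop) : Prop :=
  ∀ (ι : Type u) [Preorder ι] [IsDirected ι (· ≤ ·)] [Nonempty ι] [DecidableEq ι]
    (G : ι → ModuleCat.{u} R) (f : ∀ i j, i ≤ j → G i →ₗ[R] G j)
    [DirectedSystem (fun i => (G i : Type u)) (fun i j h => f i j h)],
    (∀ i, P (G i)) →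
      P (ModuleCat.of R (Module.DirectLimit (fun i => (G i : Type u)) f))

/-- The trace functor of `T` commutes with direct limits: the trace of a direct limit is
the supremum of the images of the traces of the components. -/
def TraceCommutesWithDirectLimits (R : Type u) [Ring R] (T : Type u) [AddCommGroup T]
    [Module R T] : Prop :=
  ∀ (ι : Type u) [Preorder ι] [IsDirected ι (· ≤ ·)] [Nonempty ι] [DecidableEq ι]
    (G : ι → ModuleCat.{u} R) (f : ∀ i j, i ≤ j → G i →ₗ[R] G j)
    [DirectedSystem (fun i => (G i : Type u)) (fun i j h => f i j h)],
    traceSub R T (Module.DirectLimit (fun i => (G i : Type u)) f) =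
      ⨆ α, (traceSub R T (G α)).map (Module.DirectLimit.of R ι (fun i => (G i : Type u)) f α)

/-- `T` is an `n`-tilting module: (T1) `pd T ≤ n` (expressed by the vanishing of
`Ext^i(T, -)` for `i > n`), (T2) `Ext^i(T, T^{(κ)}) = 0` for all `i ≥ 1` and all index
sets `κ`, (T3) `R` admits a finite exact coresolution by modules in `Add T`. -/
def IsNTilting (R : Type u) [Ring R] (n : ℕ) (T : Type u) [AddCommGroup T]
    [Module R T] : Prop :=
  (∀ (X : ModuleCat.{u} R) (i : ℕ), n < i → ExtVanish R i (ModuleCat.of R T) X) ∧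
  (∀ (κ : Type u) (i : ℕ), 1 ≤ i →
    ExtVanish R i (ModuleCat.of R T) (ModuleCat.of R (κ →₀ T))) ∧
  (∃ (U : ℕ → ModuleCat.{u} R) (ε : ModuleCat.of R R ⟶ U 0) (d : ∀ i, U i ⟶ U (i + 1)),
    (∀ i, MemAddT R T (U i)) ∧ Function.Injective ε ∧ Function.Exact ε (d 0) ∧
    (∀ i, Function.Exact (d i) (d (i + 1))) ∧ ∃ r, ∀ i, r < i → Subsingleton (U i))

/-- Vanishing of `Ext¹` in terms of a projective resolution: every `1`-cocycle is a
coboundary. -/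
lemma extVanish_one_iff {R : Type u} [Ring R] {M : ModuleCat.{u} R}
    (P : ProjectiveResolution M) (X : ModuleCat.{u} R) :
    ExtVanish R 1 M X ↔
      ∀ f : P.complex.X 1 ⟶ X, P.complex.d 2 1 ≫ f = 0 →
        ∃ g : P.complex.X 0 ⟶ X, P.complex.d 1 0 ≫ g = f := by
  rw [ExtVanish, ← ModuleCat.isZero_iff_subsingleton, (P.isoExt 1 X).isZero_iff,
    ← HomologicalComplex.exactAt_iff_isZero_homology,
    HomologicalComplex.exactAt_iff' _ 0 1 2 (by simp) (by simp),
    ShortComplex.moduleCat_exact_iff]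
  rfl

/-- Maps from a pure projective module lift along the quotient by a pure submodule. -/
lemma IsPureProjective.exists_lift {R : Type u} [Ring R] {M : Type u} [AddCommGroup M]
    [Module R M] (hM : IsPureProjective R M) {X : Type u} [AddCommGroup X] [Module R X]
    {Y : Submodule R X} (hpure : IsPureSubmodule R X Y) (f : M →ₗ[R] X ⧸ Y) :
    ∃ h : M →ₗ[R] X, Y.mkQ ∘ₗ h = f := by
  classical
  obtain ⟨ι, F, hF, s, r, hrs⟩ := hM
  choose h hh using fun i => hpure (F i) (hF i) (f ∘ₗ r ∘ₗ DirectSum.lof R ι (fun i => F i) i)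
  have key : Y.mkQ ∘ₗ DirectSum.toModule R ι X h = f ∘ₗ r := by
    refine DirectSum.linearMap_ext R fun i => ?_
    rw [LinearMap.comp_assoc, LinearMap.comp_assoc, ← hh i]
    congr 1
    ext x
    simp
  refine ⟨DirectSum.toModule R ι X h ∘ₗ s, ?_⟩
  rw [← LinearMap.comp_assoc, key, LinearMap.comp_assoc, hrs, LinearMap.comp_id]

/-- If `M` is pure projective, the class `M^{⊥₁}` is closed under pure submodules. -/
theorem stmt1 (R : Type u) [Ring R] (M : Type u) [AddCommGroup M] [Module R M]
    (hM : IsPureProjective R M)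
    (X : Type u) [AddCommGroup X] [Module R X] (Y : Submodule R X)
    (hpure : IsPureSubmodule R X Y)
    (hX : ExtVanish R 1 (ModuleCat.of R M) (ModuleCat.of R X)) :
    ExtVanish R 1 (ModuleCat.of R M) (ModuleCat.of R Y) := by
  let P := projectiveResolution (ModuleCat.of R M)
  rw [extVanish_one_iff P] at hX ⊢
  intro f hf
  let i : ModuleCat.of R Y ⟶ ModuleCat.of R X := ModuleCat.ofHom Y.subtype
  let q : ModuleCat.of R X ⟶ ModuleCat.of R (X ⧸ Y) := ModuleCat.ofHom Y.mkQ
  have hiq : i ≫ q = 0 := by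
    ext y
    simp [i, q]
  obtain ⟨g, hg⟩ := hX (f ≫ i) (by rw [reassoc_of% hf, zero_comp])
  obtain ⟨p, hp, l, hl⟩ : ∃ p : P.complex.X 0 ⟶ ModuleCat.of R M, P.complex.d 1 0 ≫ p = 0 ∧
      ∃ l : ModuleCat.of R M ⟶ ModuleCat.of R (X ⧸ Y), p ≫ l = g ≫ q :=
    let l := CokernelCofork.IsColimit.desc' P.isColimitCokernelCofork (g ≫ q)
      (by rw [reassoc_of% hg, hiq, comp_zero])
    ⟨P.π.f 0, P.complex_d_comp_π_f_zero, l.1, l.2⟩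
  obtain ⟨h, hh⟩ := hM.exists_lift hpure l.hom
  let g' : P.complex.X 0 ⟶ ModuleCat.of R X := g - p ≫ ModuleCat.ofHom h
  have hg'q : g' ≫ q = 0 := by
    have : ModuleCat.ofHom h ≫ q = l := ModuleCat.hom_ext hh
    rw [Preadditive.sub_comp, Category.assoc, this, hl, sub_self]
  have hmem (x : P.complex.X 0) : g' x ∈ Y :=
    (Submodule.Quotient.mk_eq_zero Y).1 (ConcreteCategory.congr_hom hg'q x)
  refine ⟨ModuleCat.ofHom (g'.hom.codRestrict Y hmem), ?_⟩
  have : Mono i := (ModuleCat.mono_iff_injective i).2 Y.injective_subtype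
  rw [← cancel_mono i, Category.assoc, ← hg]
  change P.complex.d 1 0 ≫ g' = _
  rw [Preadditive.comp_sub, reassoc_of% hp, zero_comp, sub_zero]

end
end

section
/- Let R be a ring, M a pure projective right R-module all of whose syzygies Ω_j(M) (with respect to some projective resolution) are pure projective. Then for every i ≥ 1, the class M^{⊥_i} = {X : Ext^i_R(M, X) = 0} is closed under direct limits. -/
open CategoryTheory Limits DirectSum

universe u

noncomputable section

section Lifting

variable {R : Type*} [Ring R]

lemma LinearMap.exists_comp_eq_of_ker_le {P C X : Type*} [AddCommGroup P] [Module R P]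
    [AddCommGroup C] [Module R C] [AddCommGroup X] [Module R X] {g : P →ₗ[R] C}
    (hg : Function.Surjective g) {φ : P →ₗ[R] X} (hle : LinearMap.ker g ≤ LinearMap.ker φ) :
    ∃ u : C →ₗ[R] X, u ∘ₗ g = φ := by
  refine ⟨(LinearMap.ker g).liftQ φ hle ∘ₗ (g.quotKerEquivOfSurjective hg).symm.toLinearMap,
    LinearMap.ext fun x ↦ ?_⟩
  have : (g.quotKerEquivOfSurjective hg).symm (g x) = Submodule.Quotient.mk x := by
    rw [LinearEquiv.symm_apply_eq]; rfl
  simp only [LinearMap.comp_apply, LinearEquiv.coe_coe, this]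
  rfl

/-- A finitely presented module lifts along a surjection `p` such that every finite subset of
the kernel is annihilated by some endomorphism over `p`. -/
lemma Module.FinitePresentation.exists_lift_of_exists_endomorphism
    {F X Y : Type*} [AddCommGroup F] [Module R F] [AddCommGroup X] [Module R X]
    [AddCommGroup Y] [Module R Y] [Module.FinitePresentation R F]
    (p : X →ₗ[R] Y) (hp : Function.Surjective p)
    (hker : ∀ S : Finset X, (∀ x ∈ S, p x = 0) →
      ∃ θ : X →ₗ[R] X, p ∘ₗ θ = p ∧ ∀ x ∈ S, θ x = 0)
    (h : F →ₗ[R] Y) : ∃ h' : F →ₗ[R] X, p ∘ₗ h' = h := by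
  classical
  obtain ⟨n, Q, e, S, rfl⟩ := Module.FinitePresentation.exists_fin R F
  obtain ⟨b, hb⟩ := Module.projective_lifting_property p
    (h ∘ₗ e.symm.toLinearMap ∘ₗ (Submodule.span R (S : Set (Fin n → R))).mkQ) hp
  obtain ⟨θ, hθ, hS⟩ := hker (S.image b) fun x hx ↦ by
    obtain ⟨s, hs, rfl⟩ := Finset.mem_image.mp hx
    have : Submodule.Quotient.mk (p := Submodule.span R (S : Set (Fin n → R))) s = 0 :=
      (Submodule.Quotient.mk_eq_zero _).mpr (Submodule.subset_span hs)
    simpa [this] using LinearMap.congr_fun hb s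
  have hle : Submodule.span R (S : Set (Fin n → R)) ≤ LinearMap.ker (θ ∘ₗ b) :=
    Submodule.span_le.mpr fun s hs ↦ hS _ (Finset.mem_image_of_mem b hs)
  refine ⟨Submodule.liftQ _ (θ ∘ₗ b) hle ∘ₗ e.toLinearMap, LinearMap.ext fun x ↦ ?_⟩
  obtain ⟨y, hy⟩ := Submodule.mkQ_surjective _ (e x)
  have hx : e.symm (Submodule.mkQ _ y) = x := by rw [hy, e.symm_apply_apply]
  have h₁ := LinearMap.congr_fun hθ (b y)
  have h₂ := LinearMap.congr_fun hb y
  simp only [LinearMap.comp_apply, LinearEquiv.coe_coe, hx] at h₁ h₂ ⊢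
  rw [← hy, Submodule.mkQ_apply, Submodule.liftQ_apply, LinearMap.comp_apply, h₁, h₂]

/-- Every finite set of families of finite support can be annihilated by an endomorphism of the
product which is the identity modulo the direct sum. -/
lemma DirectSum.exists_endomorphism_range_coeFnLinearMap {ι : Type*} {N : ι → Type*}
    [∀ α, AddCommGroup (N α)] [∀ α, Module R (N α)] (S : Finset (∀ α, N α))
    (hS : ∀ x ∈ S, (LinearMap.range (DirectSum.coeFnLinearMap R (M := N))).mkQ x = 0) :
    ∃ θ : (∀ α, N α) →ₗ[R] (∀ α, N α),
      (LinearMap.range (DirectSum.coeFnLinearMap R (M := N))).mkQ ∘ₗ θ =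
        (LinearMap.range (DirectSum.coeFnLinearMap R (M := N))).mkQ ∧ ∀ x ∈ S, θ x = 0 := by
  classical
  obtain ⟨T, hT⟩ : ∃ T : Finset ι, ∀ x ∈ S, ∀ α ∉ T, x α = 0 := by
    have (x : ∀ α, N α) (hx : x ∈ S) : ∃ T : Finset ι, ∀ α ∉ T, x α = 0 := by
      obtain ⟨y, rfl⟩ := (Submodule.Quotient.mk_eq_zero _).mp (hS x hx)
      exact ⟨y.support, fun α hα ↦ DFinsupp.notMem_support_iff.mp hα⟩
    choose! T hT using this
    exact ⟨S.biUnion T, fun x hx α hα ↦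
      hT x hx α fun h ↦ hα (Finset.mem_biUnion.mpr ⟨x, hx, h⟩)⟩
  refine ⟨LinearMap.pi fun α ↦ if α ∈ T then 0 else LinearMap.proj α,
    LinearMap.ext fun x ↦ ?_, fun x hx ↦ funext fun α ↦ ?_⟩
  · refine (Submodule.Quotient.eq _).mpr ⟨-DFinsupp.mk T fun α ↦ x α, funext fun α ↦ ?_⟩
    by_cases hα : α ∈ T <;> simp [hα]
  · by_cases hα : α ∈ T <;> simp [hα, hT x hx]

section DirectLimit

variable {ι : Type*} [Preorder ι] [DecidableEq ι]
  {N : ι → Type*} [∀ α, AddCommGroup (N α)] [∀ α, Module R (N α)]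
  (t : ∀ α β, α ≤ β → N α →ₗ[R] N β)

variable (R N) in
/-- The canonical projection from the direct sum of a directed system onto its direct limit. -/
def Module.DirectLimit.ofDirectSum : (⨁ α, N α) →ₗ[R] Module.DirectLimit N t :=
  DirectSum.toModule R ι _ (Module.DirectLimit.of R ι N t)

@[simp]
lemma Module.DirectLimit.ofDirectSum_lof (α : ι) (x : N α) :
    ofDirectSum R N t (DirectSum.lof R ι N α x) = of R ι N t α x :=
  DirectSum.toModule_lof ..

lemma Module.DirectLimit.ofDirectSum_surjective [IsDirected ι (· ≤ ·)] [Nonempty ι] :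
    Function.Surjective (ofDirectSum R N t) := fun z ↦ by
  obtain ⟨α, x, rfl⟩ := exists_of z
  exact ⟨DirectSum.lof R ι N α x, by simp⟩

open Classical in
variable (R N) in
/-- The endomorphism of a direct sum of a directed system which moves all components of index
at most `β` to the component of index `β`. -/
def Module.DirectLimit.pushTo (β : ι) : (⨁ α, N α) →ₗ[R] (⨁ α, N α) :=
  DirectSum.toModule R ι _ fun α ↦
    if h : α ≤ β then DirectSum.lof R ι N β ∘ₗ t α β h else DirectSum.lof R ι N α

lemma Module.DirectLimit.pushTo_lof {α β : ι} (h : α ≤ β) (x : N α) :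
    pushTo R N t β (DirectSum.lof R ι N α x) = DirectSum.lof R ι N β (t α β h x) := by
  simp [pushTo, h]

lemma Module.DirectLimit.ofDirectSum_comp_pushTo (β : ι) :
    ofDirectSum R N t ∘ₗ pushTo R N t β = ofDirectSum R N t := by
  refine DirectSum.linearMap_ext R fun α ↦ LinearMap.ext fun x ↦ ?_
  by_cases h : α ≤ β
  · simp [pushTo_lof t h]
  · simp [pushTo, h]

variable [IsDirected ι (· ≤ ·)] [Nonempty ι] [DirectedSystem N (fun α β h => t α β h)]

lemma Module.DirectLimit.exists_pushTo_eq_lof (x : ⨁ α, N α) :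
    ∃ (β : ι) (y : N β), ∀ γ, ∀ h : β ≤ γ,
      pushTo R N t γ x = DirectSum.lof R ι N γ (t β γ h y) := by
  induction x using DirectSum.induction_on with
  | zero => exact ⟨Classical.arbitrary ι, 0, fun γ h ↦ by simp⟩
  | of α x =>
    exact ⟨α, x, fun γ h ↦ pushTo_lof t h x⟩
  | add x₁ x₂ h₁ h₂ =>
    obtain ⟨β₁, y₁, h₁⟩ := h₁
    obtain ⟨β₂, y₂, h₂⟩ := h₂
    obtain ⟨β, hβ₁, hβ₂⟩ := exists_ge_ge β₁ β₂
    refine ⟨β, t β₁ β hβ₁ y₁ + t β₂ β hβ₂ y₂, fun γ h ↦ ?_⟩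
    rw [map_add, map_add, map_add, h₁ γ (hβ₁.trans h), h₂ γ (hβ₂.trans h),
      DirectedSystem.map_map (fun α β h => t α β h) hβ₁ h,
      DirectedSystem.map_map (fun α β h => t α β h) hβ₂ h]

lemma Module.DirectLimit.exists_pushTo_eq_zero {x : ⨁ α, N α} (hx : ofDirectSum R N t x = 0) :
    ∃ β, ∀ γ, β ≤ γ → pushTo R N t γ x = 0 := by
  obtain ⟨β, y, hy⟩ := exists_pushTo_eq_lof t x
  have : of R ι N t β y = 0 := by
    rw [← hx, ← ofDirectSum_comp_pushTo t β, LinearMap.comp_apply, hy β le_rfl]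
    simp
  obtain ⟨γ, hγ, h₀⟩ := of.zero_exact this
  refine ⟨γ, fun δ hδ ↦ ?_⟩
  rw [hy δ (hγ.trans hδ), ← DirectedSystem.map_map (fun α β h => t α β h) hγ hδ, h₀, map_zero,
    map_zero]

lemma Module.DirectLimit.exists_endomorphism_directSum (S : Finset (⨁ α, N α))
    (hS : ∀ x ∈ S, ofDirectSum R N t x = 0) :
    ∃ θ : (⨁ α, N α) →ₗ[R] (⨁ α, N α),
      ofDirectSum R N t ∘ₗ θ = ofDirectSum R N t ∧ ∀ x ∈ S, θ x = 0 := by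
  classical
  choose! β hβ using fun x hx ↦ exists_pushTo_eq_zero t (hS x hx)
  obtain ⟨γ, hγ⟩ := (S.image β).exists_le
  exact ⟨pushTo R N t γ, ofDirectSum_comp_pushTo t γ,
    fun x hx ↦ hβ x hx γ (hγ _ (Finset.mem_image_of_mem β hx))⟩

end DirectLimit

end Lifting

lemma IsPureProjective.of_equiv {R : Type u} [Ring R] {A B : Type u} [AddCommGroup A] [Module R A]
    [AddCommGroup B] [Module R B] (hA : IsPureProjective R A) (e : B ≃ₗ[R] A) :
    IsPureProjective R B := by
  obtain ⟨κ, F, hF, s, r, hrs⟩ := hA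
  refine ⟨κ, F, hF, s ∘ₗ e.toLinearMap, e.symm.toLinearMap ∘ₗ r, LinearMap.ext fun x ↦ ?_⟩
  simpa using congr_arg e.symm (LinearMap.congr_fun hrs (e x))

lemma IsPureProjective.exists_lift_s2 {R : Type u} [Ring R] {A : Type u} [AddCommGroup A]
    [Module R A] (hA : IsPureProjective R A) {X Y : Type*} [AddCommGroup X] [Module R X]
    [AddCommGroup Y] [Module R Y] (p : X →ₗ[R] Y) (hp : Function.Surjective p)
    (hker : ∀ S : Finset X, (∀ x ∈ S, p x = 0) →
      ∃ θ : X →ₗ[R] X, p ∘ₗ θ = p ∧ ∀ x ∈ S, θ x = 0)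
    (h : A →ₗ[R] Y) : ∃ h' : A →ₗ[R] X, p ∘ₗ h' = h := by
  classical
  obtain ⟨κ, F, hF, s, r, hrs⟩ := hA
  choose l hl using fun k ↦
    Module.FinitePresentation.exists_lift_of_exists_endomorphism p hp hker
      (h ∘ₗ r ∘ₗ DirectSum.lof R κ (fun k ↦ (F k : Type u)) k)
  refine ⟨DirectSum.toModule R κ X l ∘ₗ s, ?_⟩
  have : p ∘ₗ DirectSum.toModule R κ X l = h ∘ₗ r :=
    DirectSum.linearMap_ext R fun k ↦ LinearMap.ext fun x ↦ by
      simpa using LinearMap.congr_fun (hl k) x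
  rw [← LinearMap.comp_assoc, this, LinearMap.comp_assoc, hrs, LinearMap.comp_id]

/-- If every map `A → N α` extends along `f : A → P`, and both `A` and the cokernel `C` of `f` are
pure projective, then every map from `A` to the direct limit of the `N α` extends along `f`. -/
lemma IsPureProjective.exists_extension_directLimit {R : Type u} [Ring R] {A C : Type u}
    [AddCommGroup A] [Module R A] [AddCommGroup C] [Module R C]
    (hA : IsPureProjective R A) (hC : IsPureProjective R C)
    {P : Type*} [AddCommGroup P] [Module R P] (f : A →ₗ[R] P) (g : P →ₗ[R] C)
    (hg : Function.Surjective g) (hfg : Function.Exact f g)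
    {ι : Type*} [Preorder ι] [IsDirected ι (· ≤ ·)] [Nonempty ι] [DecidableEq ι]
    {N : ι → Type*} [∀ α, AddCommGroup (N α)] [∀ α, Module R (N α)]
    (t : ∀ α β, α ≤ β → N α →ₗ[R] N β) [DirectedSystem N (fun α β h => t α β h)]
    (hN : ∀ α, ∀ h : A →ₗ[R] N α, ∃ q : P →ₗ[R] N α, q ∘ₗ f = h)
    (h : A →ₗ[R] Module.DirectLimit N t) :
    ∃ q : P →ₗ[R] Module.DirectLimit N t, q ∘ₗ f = h := by
  obtain ⟨h', rfl⟩ := hA.exists_lift_s2 (Module.DirectLimit.ofDirectSum R N t)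
    (Module.DirectLimit.ofDirectSum_surjective t)
    (Module.DirectLimit.exists_endomorphism_directSum t) h
  let c : (⨁ α, N α) →ₗ[R] ∀ α, N α := DirectSum.coeFnLinearMap R
  have hc : Function.Injective c := DFunLike.coe_injective
  choose q hq using fun α ↦ hN α (LinearMap.proj α ∘ₗ c ∘ₗ h')
  have hqf (a : A) : LinearMap.pi q (f a) = c (h' a) :=
    funext fun α ↦ LinearMap.congr_fun (hq α) a
  let D := LinearMap.range c
  have hle : LinearMap.ker g ≤ LinearMap.ker (D.mkQ ∘ₗ LinearMap.pi q) := fun x hx ↦ by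
    obtain ⟨a, rfl⟩ := (hfg x).mp hx
    rw [LinearMap.mem_ker, LinearMap.comp_apply, hqf]
    exact (Submodule.Quotient.mk_eq_zero _).mpr ⟨h' a, rfl⟩
  obtain ⟨u, hu⟩ := LinearMap.exists_comp_eq_of_ker_le hg hle
  obtain ⟨v, hv⟩ := hC.exists_lift_s2 D.mkQ D.mkQ_surjective
    DirectSum.exists_endomorphism_range_coeFnLinearMap u
  have hmem (x : P) : (LinearMap.pi q - v ∘ₗ g) x ∈ D := by
    rw [← Submodule.Quotient.mk_eq_zero, ← Submodule.mkQ_apply, LinearMap.sub_apply, map_sub,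
      sub_eq_zero]
    exact (LinearMap.congr_fun hu x).symm.trans (LinearMap.congr_fun hv (g x)).symm
  refine ⟨Module.DirectLimit.ofDirectSum R N t ∘ₗ (LinearEquiv.ofInjective c hc).symm.toLinearMap
    ∘ₗ LinearMap.codRestrict D _ hmem, LinearMap.ext fun a ↦ ?_⟩
  have : (LinearEquiv.ofInjective c hc).symm
      (LinearMap.codRestrict D (LinearMap.pi q - v ∘ₗ g) hmem (f a)) = h' a := by
    rw [LinearEquiv.symm_apply_eq]
    refine Subtype.ext ?_
    have hgf : g (f a) = 0 := hfg.apply_apply_eq_zero a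
    simp [hqf, hgf]
  simp only [LinearMap.comp_apply, LinearEquiv.coe_coe, this]

section Syzygies

variable {R : Type u} [Ring R] {K P : ℕ → ModuleCat.{u} R}
  (f : ∀ j, (K (j + 1) : Type u) →ₗ[R] P j) (g : ∀ j, (P j : Type u) →ₗ[R] K j)

/-- The chain complex obtained by splicing short exact sequences `0 → K (j+1) → P j → K j → 0`. -/
def spliceComplex (hexact : ∀ j, Function.Exact (f j) (g j)) :
    ChainComplex (ModuleCat.{u} R) ℕ :=
  ChainComplex.of P (fun n ↦ ModuleCat.ofHom (f n ∘ₗ g (n + 1))) fun n ↦ by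
    ext x
    simp [(hexact (n + 1)).apply_apply_eq_zero]

lemma spliceComplex_d (hexact : ∀ j, Function.Exact (f j) (g j)) (n : ℕ) :
    (spliceComplex f g hexact).d (n + 1) n = ModuleCat.ofHom (f n ∘ₗ g (n + 1)) :=
  ChainComplex.of_d (V := ModuleCat.{u} R) P (fun n ↦ ModuleCat.ofHom (f n ∘ₗ g (n + 1))) n

/-- The augmentation of `spliceComplex` given by `g 0 : P 0 → K 0`. -/
def spliceAugmentation (hexact : ∀ j, Function.Exact (f j) (g j)) :
    spliceComplex f g hexact ⟶ (ChainComplex.single₀ _).obj (K 0) :=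
  (ChainComplex.toSingle₀Equiv _ _).symm ⟨ModuleCat.ofHom (g 0), by
    rw [spliceComplex_d]
    ext x
    exact (hexact 0).apply_apply_eq_zero _⟩

lemma spliceAugmentation_f_zero (hexact : ∀ j, Function.Exact (f j) (g j)) :
    (spliceAugmentation f g hexact).f 0 = ModuleCat.ofHom (g 0) :=
  ChainComplex.toSingle₀Equiv_symm_apply_f_zero ..

lemma spliceComplex_exactAt_succ (hexact : ∀ j, Function.Exact (f j) (g j))
    (hinj : ∀ j, Function.Injective (f j))
    (hsurj : ∀ j, Function.Surjective (g j)) (n : ℕ) :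
    (spliceComplex f g hexact).ExactAt (n + 1) := by
  rw [HomologicalComplex.exactAt_iff' _ (n + 2) (n + 1) n (by simp) (by simp),
    ShortComplex.moduleCat_exact_iff]
  intro (x : P (n + 1)) hx
  change (spliceComplex f g hexact).d (n + 1) n x = 0 at hx
  change ∃ y, (spliceComplex f g hexact).d (n + 2) (n + 1) y = x
  rw [spliceComplex_d] at hx ⊢
  obtain ⟨y, rfl⟩ := (hexact (n + 1) x).mp (hinj n (hx.trans (map_zero _).symm))
  obtain ⟨z, rfl⟩ := hsurj (n + 2) y
  exact ⟨z, rfl⟩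

/-- The projective resolution obtained by splicing short exact sequences
`0 → K (j+1) → P j → K j → 0` with `P j` projective. -/
def spliceResolution (hexact : ∀ j, Function.Exact (f j) (g j))
    (hinj : ∀ j, Function.Injective (f j)) (hsurj : ∀ j, Function.Surjective (g j))
    (hproj : ∀ j, Module.Projective R (P j)) : ProjectiveResolution (K 0) where
  complex := spliceComplex f g hexact
  projective n := (IsProjective.iff_projective (P n)).mp (hproj n)
  π := spliceAugmentation f g hexact
  quasiIso := ⟨fun n ↦ by
    cases n with
    | zero =>
      rw [ChainComplex.quasiIsoAt₀_iff, ShortComplex.quasiIso_iff_of_zeros' _ rfl rfl rfl]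
      refine ⟨?_, ?_⟩
      · rw [ShortComplex.moduleCat_exact_iff]
        intro (x : P 0) hx
        change (spliceAugmentation f g hexact).f 0 x = 0 at hx
        change ∃ y, (spliceComplex f g hexact).d 1 0 y = x
        rw [spliceAugmentation_f_zero] at hx
        rw [spliceComplex_d]
        obtain ⟨y, rfl⟩ := (hexact 0 x).mp hx
        obtain ⟨z, rfl⟩ := hsurj 1 y
        exact ⟨z, rfl⟩
      · change Epi ((spliceAugmentation f g hexact).f 0)
        rw [spliceAugmentation_f_zero]
        exact (ModuleCat.epi_iff_surjective _).mpr (hsurj 0)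
    | succ n =>
      rw [quasiIsoAt_iff_exactAt' _ _ (ChainComplex.exactAt_succ_single_obj _ _)]
      exact spliceComplex_exactAt_succ f g hexact hinj hsurj n⟩

lemma extVanish_succ_iff (hexact : ∀ j, Function.Exact (f j) (g j))
    (hinj : ∀ j, Function.Injective (f j)) (hsurj : ∀ j, Function.Surjective (g j))
    (hproj : ∀ j, Module.Projective R (P j)) (n : ℕ) (X : ModuleCat.{u} R) :
    ExtVanish R (n + 1) (K 0) X ↔
      ∀ h : K (n + 1) →ₗ[R] X, ∃ q : P n →ₗ[R] X, q ∘ₗ f n = h := by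
  have e := (spliceResolution f g hexact hinj hsurj hproj).isoExt (R := ℤ) (n + 1) X
  rw [ExtVanish, ← ModuleCat.isZero_iff_subsingleton, e.isZero_iff,
    ← HomologicalComplex.exactAt_iff_isZero_homology,
    HomologicalComplex.exactAt_iff' _ n (n + 1) (n + 2) (by simp) (by simp),
    ShortComplex.moduleCat_exact_iff]
  change (∀ φ : P (n + 1) ⟶ X, (spliceComplex f g hexact).d (n + 2) (n + 1) ≫ φ = 0 →
    ∃ q : P n ⟶ X, (spliceComplex f g hexact).d (n + 1) n ≫ q = φ) ↔ _
  rw [spliceComplex_d, spliceComplex_d]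
  refine ⟨fun H h ↦ ?_, fun H φ hφ ↦ ?_⟩
  · have hφ : ModuleCat.ofHom (f (n + 1) ∘ₗ g (n + 2)) ≫ ModuleCat.ofHom (h ∘ₗ g (n + 1)) = 0 :=
      ModuleCat.hom_ext (LinearMap.ext fun x ↦ by
        simp [(hexact (n + 1)).apply_apply_eq_zero])
    obtain ⟨q, hq⟩ := H (ModuleCat.ofHom (h ∘ₗ g (n + 1))) hφ
    refine ⟨q.hom, LinearMap.ext fun x ↦ ?_⟩
    obtain ⟨y, rfl⟩ := hsurj (n + 1) x
    exact LinearMap.congr_fun (congr_arg ModuleCat.Hom.hom hq) y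
  · have hle : LinearMap.ker (g (n + 1)) ≤ LinearMap.ker φ.hom := fun x hx ↦ by
      obtain ⟨y, rfl⟩ := (hexact (n + 1) x).mp hx
      obtain ⟨z, rfl⟩ := hsurj (n + 2) y
      exact LinearMap.congr_fun (congr_arg ModuleCat.Hom.hom hφ) z
    obtain ⟨u, hu⟩ := LinearMap.exists_comp_eq_of_ker_le (hsurj (n + 1)) hle
    obtain ⟨q, rfl⟩ := H u
    exact ⟨ModuleCat.ofHom q, ModuleCat.hom_ext hu⟩

end Syzygies

lemma ExtVanish.congr_left {R : Type u} [Ring R] {n : ℕ} {A B : ModuleCat.{u} R} (e : A ≅ B)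
    (X : ModuleCat.{u} R) : ExtVanish R n A X ↔ ExtVanish R n B X := by
  rw [ExtVanish, ExtVanish, ← ModuleCat.isZero_iff_subsingleton,
    ← ModuleCat.isZero_iff_subsingleton]
  exact (((Ext ℤ (ModuleCat.{u} R) n).mapIso e.op).app X).symm.isZero_iff

/-- If `M` is pure projective and all its syzygies (with respect to a projective
resolution, encoded by the short exact sequences `0 → K (j+1) → P j → K j → 0` with
`K 0 ≅ M` and each `P j` projective) are pure projective, then for every `i ≥ 1`
the class `M^{⊥_i}` is closed under direct limits. -/
theorem stmt2 (R : Type u) [Ring R] (M : Type u) [AddCommGroup M] [Module R M]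
    (hM : IsPureProjective R M)
    (K P : ℕ → ModuleCat.{u} R) (e : (K 0 : Type u) ≃ₗ[R] M)
    (hproj : ∀ j, Module.Projective R (P j))
    (f : ∀ j, (K (j + 1) : Type u) →ₗ[R] P j) (g : ∀ j, (P j : Type u) →ₗ[R] K j)
    (hinj : ∀ j, Function.Injective (f j)) (hsurj : ∀ j, Function.Surjective (g j))
    (hexact : ∀ j, Function.Exact (f j) (g j))
    (hsyz : ∀ j, IsPureProjective R (K (j + 1)))
    (i : ℕ) (hi : 1 ≤ i)
    (ι : Type u) [Preorder ι] [IsDirected ι (· ≤ ·)] [Nonempty ι] [DecidableEq ι]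
    (N : ι → Type u) [∀ α, AddCommGroup (N α)] [∀ α, Module R (N α)]
    (t : ∀ α β, α ≤ β → N α →ₗ[R] N β)
    [DirectedSystem N (fun α β h => t α β h)]
    (hN : ∀ α, ExtVanish R i (ModuleCat.of R M) (ModuleCat.of R (N α))) :
    ExtVanish R i (ModuleCat.of R M) (ModuleCat.of R (Module.DirectLimit N t)) := by
  obtain ⟨n, rfl⟩ := Nat.exists_eq_add_of_le' hi
  have hK (j : ℕ) : IsPureProjective R (K j) := by
    cases j with
    | zero => exact hM.of_equiv e
    | succ j => exact hsyz j
  simp only [← ExtVanish.congr_left (A := K 0) e.toModuleIso,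
    extVanish_succ_iff f g hexact hinj hsurj hproj] at hN ⊢
  exact (hK (n + 1)).exists_extension_directLimit (hK n) (f n) (g n) (hsurj n) (hexact n) t hN

end
end

section
/- Let R be a ring and T a right R-module admitting an exact sequence 0 → R → T' → T'/R → 0 with T' ∈ Add T as above. Then the trace functor tr_T commutes with direct limits if and only if there exists a finitely presented right R-module A and an element a ∈ tr_T(A) such that tr_T is naturally isomorphic to the functor N ↦ {f(a) : f ∈ Hom_R(A, N)}. -/
open CategoryTheory Limits DirectSum

universe u

noncomputable section

/-- A finitely generated submodule that dies in a direct limit already dies at a finite stage. -/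
theorem exists_le_ker_of_fg {R ι M : Type*} [Ring R] [Preorder ι] [IsDirected ι (· ≤ ·)]
    [DecidableEq ι] [AddCommGroup M] [Module R M] (G : ι → Type*) [∀ i, AddCommGroup (G i)]
    [∀ i, Module R (G i)] (f : ∀ i j, i ≤ j → G i →ₗ[R] G j)
    [DirectedSystem G (fun i j h => f i j h)] {i : ι} (h : M →ₗ[R] G i) (K : Submodule R M)
    (hK : K.FG) (hle : K ≤ LinearMap.ker (Module.DirectLimit.of R ι G f i ∘ₗ h)) :
    ∃ (j : ι) (hij : i ≤ j), K ≤ LinearMap.ker (f i j hij ∘ₗ h) := by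
  induction K, hK using Submodule.fg_induction with
  | singleton x =>
    rw [Submodule.span_singleton_le_iff_mem, LinearMap.mem_ker] at hle
    obtain ⟨j, hij, hj⟩ := Module.DirectLimit.of.zero_exact hle
    exact ⟨j, hij, by rwa [Submodule.span_singleton_le_iff_mem]⟩
  | sup K₁ K₂ _ _ h₁ h₂ =>
    obtain ⟨j₁, hij₁, hj₁⟩ := h₁ (le_sup_left.trans hle)
    obtain ⟨j₂, hij₂, hj₂⟩ := h₂ (le_sup_right.trans hle)
    obtain ⟨k, hk₁, hk₂⟩ := exists_ge_ge j₁ j₂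
    refine ⟨k, hij₁.trans hk₁, sup_le (fun x hx => ?_) (fun x hx => ?_)⟩
    · have hx := hj₁ hx
      simp only [LinearMap.mem_ker, LinearMap.comp_apply] at hx ⊢
      rw [← DirectedSystem.map_map (f := fun i j h => f i j h) hij₁ hk₁, hx, map_zero]
    · have hx := hj₂ hx
      simp only [LinearMap.mem_ker, LinearMap.comp_apply] at hx ⊢
      rw [← DirectedSystem.map_map (f := fun i j h => f i j h) hij₂ hk₂, hx, map_zero]

/-- A linear map from a finitely presented module to a direct limit factors through one of the
components. -/
theorem Module.FinitePresentation.exists_factor_directLimit {R ι A : Type*} [Ring R] [Preorder ι]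
    [IsDirected ι (· ≤ ·)] [Nonempty ι] [DecidableEq ι] [AddCommGroup A] [Module R A]
    [Module.FinitePresentation R A] (G : ι → Type*) [∀ i, AddCommGroup (G i)]
    [∀ i, Module R (G i)] (f : ∀ i j, i ≤ j → G i →ₗ[R] G j)
    [DirectedSystem G (fun i j h => f i j h)] (φ : A →ₗ[R] Module.DirectLimit G f) :
    ∃ (i : ι) (g : A →ₗ[R] G i), Module.DirectLimit.of R ι G f i ∘ₗ g = φ := by
  obtain ⟨n, K, e, hK⟩ := Module.FinitePresentation.exists_fin R A
  let ψ : (Fin n → R) →ₗ[R] Module.DirectLimit G f := φ ∘ₗ e.symm.toLinearMap ∘ₗ K.mkQ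
  choose i x hx using fun k => Module.DirectLimit.exists_of (ψ (Pi.basisFun R (Fin n) k))
  obtain ⟨m, hm⟩ := Finite.exists_le i
  let h : (Fin n → R) →ₗ[R] G m :=
    (Pi.basisFun R (Fin n)).constr ℕ fun k => f (i k) m (hm k) (x k)
  have hh : Module.DirectLimit.of R ι G f m ∘ₗ h = ψ := by
    refine (Pi.basisFun R (Fin n)).ext fun k => ?_
    rw [LinearMap.comp_apply, Module.Basis.constr_basis, Module.DirectLimit.of_f, hx]
  obtain ⟨j, hmj, hj⟩ := exists_le_ker_of_fg G f h K hK (by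
    rw [hh]
    intro y hy
    simp [ψ, (Submodule.Quotient.mk_eq_zero K).2 hy])
  refine ⟨j, K.liftQ _ hj ∘ₗ e.toLinearMap, LinearMap.ext fun a => ?_⟩
  obtain ⟨y, hy⟩ := K.mkQ_surjective (e a)
  have := LinearMap.congr_fun hh y
  simp only [LinearMap.comp_apply, LinearEquiv.coe_coe, ψ, hy, e.symm_apply_apply] at this
  simp only [LinearMap.comp_apply, LinearEquiv.coe_coe, ← hy, Submodule.mkQ_apply,
    Submodule.liftQ_apply, Module.DirectLimit.of_f]
  exact this

/-- The finite presentations over a module `M`: a finite set of generators, and a finitely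
generated module of relations among them. -/
abbrev FinitePresentationOver (R M : Type u) [Ring R] [AddCommGroup M] [Module R M] : Type u :=
  {p : Finset M × Submodule R (M →₀ R) // p.2.FG ∧ p.2 ≤ Finsupp.supported R R (p.1 : Set M) ⊓
    LinearMap.ker (Finsupp.linearCombination R (id : M → M))}

namespace FinitePresentationOver

variable {R M : Type u} [Ring R] [AddCommGroup M] [Module R M]

instance : Nonempty (FinitePresentationOver R M) := ⟨⟨(∅, ⊥), Submodule.fg_bot, bot_le⟩⟩

instance : IsDirected (FinitePresentationOver R M) (· ≤ ·) where
  directed p q := by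
    classical
    refine ⟨⟨p.1 ⊔ q.1, p.2.1.sup q.2.1, sup_le ?_ ?_⟩, le_sup_left (a := p.1),
      le_sup_right (b := q.1)⟩
    · exact p.2.2.trans (inf_le_inf_right _ (Finsupp.supported_mono
        (Finset.coe_subset.2 (le_sup_left (a := p.1.1)))))
    · exact q.2.2.trans (inf_le_inf_right _ (Finsupp.supported_mono
        (Finset.coe_subset.2 (le_sup_right (b := q.1.1)))))

/-- The inclusion of the free module on the generators of `p` into the free module on `M`. -/
abbrev inclusion (p : FinitePresentationOver R M) : (p.1.1 →₀ R) →ₗ[R] (M →₀ R) :=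
  Finsupp.lmapDomain R R Subtype.val

theorem range_inclusion (p : FinitePresentationOver R M) :
    LinearMap.range p.inclusion = Finsupp.supported R R (p.1.1 : Set M) := by
  rw [LinearMap.range_eq_map, ← Finsupp.supported_univ, Finsupp.lmapDomain_supported,
    Set.image_univ]
  exact congrArg _ Subtype.range_coe

/-- The relations of `p`, as a submodule of the free module on the generators of `p`. -/
abbrev relations (p : FinitePresentationOver R M) : Submodule R (p.1.1 →₀ R) :=
  p.1.2.comap p.inclusion

/-- The finitely presented module with the generators and relations of `p`. -/
def Carrier (p : FinitePresentationOver R M) : Type u :=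
  (p.1.1 →₀ R) ⧸ p.relations

instance (p : FinitePresentationOver R M) : AddCommGroup p.Carrier :=
  inferInstanceAs (AddCommGroup ((p.1.1 →₀ R) ⧸ p.relations))

instance (p : FinitePresentationOver R M) : Module R p.Carrier :=
  inferInstanceAs (Module R ((p.1.1 →₀ R) ⧸ p.relations))

/-- The projection from the free module on the generators of `p`. -/
def mk (p : FinitePresentationOver R M) : (p.1.1 →₀ R) →ₗ[R] p.Carrier :=
  p.relations.mkQ

theorem mk_surjective (p : FinitePresentationOver R M) : Function.Surjective p.mk :=
  p.relations.mkQ_surjective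

theorem ker_mk (p : FinitePresentationOver R M) : LinearMap.ker p.mk = p.relations :=
  Submodule.ker_mkQ _

theorem finitePresentation_carrier (p : FinitePresentationOver R M) :
    Module.FinitePresentation R p.Carrier := by
  refine Module.finitePresentation_of_surjective p.mk p.mk_surjective ?_
  rw [ker_mk]
  refine Submodule.fg_of_fg_map_injective p.inclusion
    (Finsupp.mapDomain_injective Subtype.val_injective) ?_
  rw [Submodule.map_comap_eq, range_inclusion, inf_eq_right.2 (p.2.2.trans inf_le_left)]
  exact p.2.1

/-- The map between the free modules on the generators of two finite presentations over `M`. -/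
abbrev generatorMap (p q : FinitePresentationOver R M) (h : p ≤ q) :
    (p.1.1 →₀ R) →ₗ[R] (q.1.1 →₀ R) :=
  Finsupp.lmapDomain R R fun x => ⟨x.1, h.1 x.2⟩

theorem inclusion_generatorMap (p q : FinitePresentationOver R M) (h : p ≤ q) (x : p.1.1 →₀ R) :
    q.inclusion (generatorMap p q h x) = p.inclusion x :=
  Finsupp.mapDomain_comp.symm

/-- The transition maps between finite presentations over `M`. -/
def transition (p q : FinitePresentationOver R M) (h : p ≤ q) : p.Carrier →ₗ[R] q.Carrier :=
  p.relations.mapQ q.relations (generatorMap p q h) fun x hx => by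
    rw [Submodule.mem_comap, Submodule.mem_comap, inclusion_generatorMap]
    exact h.2 hx

instance : DirectedSystem (fun p : FinitePresentationOver R M => p.Carrier)
    (fun p q h => transition p q h) where
  map_self p x := by
    obtain ⟨x, rfl⟩ := p.mk_surjective x
    exact congrArg p.mk Finsupp.mapDomain_id
  map_map r q p hpq hqr x := by
    obtain ⟨x, rfl⟩ := p.mk_surjective x
    exact congrArg r.mk Finsupp.mapDomain_comp.symm

/-- The map from a finitely presented module over `M` to `M`. -/
def toModule (p : FinitePresentationOver R M) : p.Carrier →ₗ[R] M :=
  p.relations.liftQ (Finsupp.linearCombination R (id : M → M) ∘ₗ p.inclusion)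
    (fun _ hx => (p.2.2 hx).2)

open Classical in
/-- The map to `M` from the direct limit of all finitely presented modules over `M`. -/
def fromDirectLimit (R M : Type u) [Ring R] [AddCommGroup M] [Module R M] :
    Module.DirectLimit (fun p : FinitePresentationOver R M => p.Carrier) transition →ₗ[R] M :=
  Module.DirectLimit.lift R _ _ _ toModule (by
    intro p q h x
    obtain ⟨x, rfl⟩ := p.mk_surjective x
    exact congrArg (Finsupp.linearCombination R (id : M → M)) (inclusion_generatorMap p q h x))

theorem fromDirectLimit_surjective : Function.Surjective (fromDirectLimit R M) := by
  classical
  intro m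
  let p : FinitePresentationOver R M := ⟨({m}, ⊥), Submodule.fg_bot, bot_le⟩
  refine ⟨Module.DirectLimit.of R _ _ _ p 
    (p.mk (Finsupp.single ⟨m, Finset.mem_singleton_self m⟩ 1)), ?_⟩
  rw [fromDirectLimit, Module.DirectLimit.lift_of]
  change Finsupp.linearCombination R (id : M → M) (Finsupp.mapDomain Subtype.val _) = m
  simp

theorem fromDirectLimit_injective : Function.Injective (fromDirectLimit R M) := by
  classical
  rw [injective_iff_map_eq_zero]
  intro z hz
  obtain ⟨p, x, rfl⟩ := Module.DirectLimit.exists_of z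
  obtain ⟨x, rfl⟩ := p.mk_surjective x
  rw [fromDirectLimit, Module.DirectLimit.lift_of] at hz
  have hx : Finsupp.linearCombination R (id : M → M) (p.inclusion x) = 0 := hz
  let q : FinitePresentationOver R M := ⟨(p.1.1, p.1.2 ⊔ Submodule.span R {p.inclusion x}),
    p.2.1.sup (Submodule.fg_span_singleton _), sup_le p.2.2 (by
      rw [Submodule.span_singleton_le_iff_mem]
      exact ⟨p.range_inclusion ▸ ⟨x, rfl⟩, hx⟩)⟩
  have hpq : p ≤ q := ⟨le_refl p.1.1, le_sup_left (a := p.1.2)⟩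
  rw [← Module.DirectLimit.of_f (hij := hpq)]
  have : transition p q hpq (p.mk x) = 0 := by
    refine (Submodule.Quotient.mk_eq_zero q.relations).2 ?_
    rw [Submodule.mem_comap, inclusion_generatorMap]
    exact Submodule.mem_sup_right (Submodule.mem_span_singleton_self _)
  rw [this, map_zero]

open Classical in
/-- Every module is the direct limit of the finitely presented modules over it. -/
def directLimitEquiv (R M : Type u) [Ring R] [AddCommGroup M] [Module R M] :
    Module.DirectLimit (fun p : FinitePresentationOver R M => p.Carrier) transition ≃ₗ[R] M :=
  LinearEquiv.ofBijective (fromDirectLimit R M)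
    ⟨fromDirectLimit_injective, fromDirectLimit_surjective⟩

end FinitePresentationOver

section Trace

variable {R T M N : Type u} [Ring R] [AddCommGroup T] [Module R T] [AddCommGroup M] [Module R M]
  [AddCommGroup N] [Module R N]

theorem map_traceSub_le (g : M →ₗ[R] N) : (traceSub R T M).map g ≤ traceSub R T N := by
  rw [traceSub, Submodule.map_iSup]
  refine iSup_le fun f => ?_
  rw [← LinearMap.range_comp]
  exact le_iSup (fun f : T →ₗ[R] N => LinearMap.range f) (g ∘ₗ f)

theorem traceSub_traceSub : traceSub R T (traceSub R T N) = ⊤ := by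
  refine Submodule.map_injective_of_injective (traceSub R T N).subtype_injective ?_
  rw [Submodule.map_subtype_top]
  refine le_antisymm (map_traceSub_le _ ) ?_
  refine iSup_le fun f => ?_
  have hf : ∀ t, f t ∈ traceSub R T N := fun t =>
    le_iSup (fun f : T →ₗ[R] N => LinearMap.range f) f ⟨t, rfl⟩
  rintro _ ⟨t, rfl⟩
  exact ⟨f.codRestrict _ hf t,
    le_iSup (fun f : T →ₗ[R] traceSub R T N => LinearMap.range f) _ ⟨t, rfl⟩, rfl⟩

theorem MemAddT.traceSub_eq_top (h : MemAddT R T M) : traceSub R T M = ⊤ := by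
  obtain ⟨κ, s, p, hps⟩ := h
  refine eq_top_iff.2 fun m _ => ?_
  have hm : p (s m) = m := LinearMap.congr_fun hps m
  rw [← hm]
  induction s m using Finsupp.induction_linear with
  | zero => simp
  | add x y hx hy => rw [map_add]; exact add_mem hx hy
  | single k t =>
    exact le_iSup (fun f : T →ₗ[R] M => LinearMap.range f) (p ∘ₗ Finsupp.lsingle k) ⟨t, rfl⟩

/-- The trace of a direct limit comes from a finite stage. -/
theorem TraceCommutesWithDirectLimits.exists_of_mem_traceSub
    (H : TraceCommutesWithDirectLimits R T) {ι : Type u} [Preorder ι] [IsDirected ι (· ≤ ·)]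
    [Nonempty ι] [DecidableEq ι] (G : ι → Type u) [∀ i, AddCommGroup (G i)]
    [∀ i, Module R (G i)] (f : ∀ i j, i ≤ j → G i →ₗ[R] G j)
    [DirectedSystem G (fun i j h => f i j h)] {z : Module.DirectLimit G f}
    (hz : z ∈ traceSub R T (Module.DirectLimit G f)) :
    ∃ i, ∃ x ∈ traceSub R T (G i), Module.DirectLimit.of R ι G f i x = z := by
  have hdir : Directed (· ≤ ·) fun i =>
      (traceSub R T (G i)).map (Module.DirectLimit.of R ι G f i) := by
    refine directed_of_isDirected_le fun i j hij => ?_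
    have hof : Module.DirectLimit.of R ι G f i = Module.DirectLimit.of R ι G f j ∘ₗ f i j hij :=
      LinearMap.ext fun x => Module.DirectLimit.of_f.symm
    rw [hof, Submodule.map_comp]
    exact Submodule.map_mono (map_traceSub_le _)
  rw [H ι (fun i => ModuleCat.of R (G i)) f] at hz
  exact (Submodule.mem_iSup_of_directed _ hdir).1 hz

end Trace

/-- Given an exact sequence `0 → R →^ε T' → T'/R → 0` with `T' ∈ Add T` and the
preenvelope property, the trace functor `tr_T` commutes with direct limits if and
only if there exist a finitely presented module `A` and an element `a ∈ tr_T(A)`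
such that `tr_T(N) = {f(a) : f ∈ Hom_R(A, N)}` naturally in `N`. -/
theorem stmt6 (R : Type u) [Ring R] (T : Type u) [AddCommGroup T] [Module R T]
    (T' : Type u) [AddCommGroup T'] [Module R T'] (ε : R →ₗ[R] T')
    (hmono : Function.Injective ε)
    (hAdd : MemAddT R T T')
    (hlift : ∀ (B : Type u) [AddCommGroup B] [Module R B], traceSub R T B = ⊤ →
      ∀ h : R →ₗ[R] B, ∃ ℓ : T' →ₗ[R] B, ℓ ∘ₗ ε = h) :
    TraceCommutesWithDirectLimits R T ↔
      ∃ A : ModuleCat.{u} R, Module.FinitePresentation R A ∧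
        ∃ a : A, a ∈ traceSub R T A ∧
          ∀ N : ModuleCat.{u} R,
            (traceSub R T N : Set N) = {x | ∃ f : A ⟶ N, f a = x} := by
  constructor
  · intro H
    classical
    let e := FinitePresentationOver.directLimitEquiv R T'
    have hw : e.symm (ε 1) ∈ traceSub R T _ :=
      map_traceSub_le e.symm.toLinearMap
        ⟨ε 1, hAdd.traceSub_eq_top ▸ Submodule.mem_top, rfl⟩
    obtain ⟨p, a, ha, hpa⟩ := H.exists_of_mem_traceSub _ _ hw
    refine ⟨ModuleCat.of R p.Carrier, p.finitePresentation_carrier, a, ha, fun N => ?_⟩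
    ext x
    constructor
    · intro hx
      obtain ⟨ℓ, hℓ⟩ := hlift (traceSub R T N) traceSub_traceSub
        (LinearMap.toSpanSingleton R _ ⟨x, hx⟩)
      refine ⟨ModuleCat.ofHom ((traceSub R T N).subtype ∘ₗ ℓ ∘ₗ e.toLinearMap ∘ₗ
        Module.DirectLimit.of R _ _ _ p), ?_⟩
      have h₁ : ℓ (ε 1) = ⟨x, hx⟩ := by
        simpa using LinearMap.congr_fun hℓ 1
      change (ℓ (e (Module.DirectLimit.of R _ _ _ p a)) : N) = x
      rw [hpa, e.apply_symm_apply, h₁]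
    · rintro ⟨g, rfl⟩
      exact map_traceSub_le g.hom ⟨a, ha, rfl⟩
  · rintro ⟨A, hA, a, ha, h⟩ ι _ _ _ _ G f _
    refine le_antisymm (fun x hx => ?_) (iSup_le fun i => map_traceSub_le _)
    obtain ⟨φ, rfl⟩ : x ∈ {x | ∃ φ : A ⟶ ModuleCat.of R (Module.DirectLimit _ f), φ a = x} := by
      rw [← h]
      exact hx
    obtain ⟨i, g, hg⟩ :=
      Module.FinitePresentation.exists_factor_directLimit (fun i => (G i : Type u)) f φ.hom
    refine Submodule.mem_iSup_of_mem i ⟨g a, map_traceSub_le g ⟨a, ha, rfl⟩, ?_⟩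
    exact LinearMap.congr_fun hg a

end
end

section
/- Let T be an n-tilting right R-module with associated t-structure (U, V) on D(R), where U = {X : Hom_{D(R)}(T[i], X) = 0 for all i < 0}. Then a complex X ∈ D(R) belongs to U if and only if X is isomorphic in D(R) to a complex concentrated in degrees ≤ 0 with all terms in Add T. -/
open CategoryTheory Limits DirectSum

universe u

noncomputable section

universe w

open Pretriangulated

section Derived

variable (R : Type u) [Ring R] [HasDerivedCategory.{w} (ModuleCat.{u} R)]

/-- A module `T`, viewed as a stalk complex in degree `0` in the derived category of `R`. -/
def singleT (T : Type u) [AddCommGroup T] [Module R T] :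
    DerivedCategory (ModuleCat.{u} R) :=
  (DerivedCategory.singleFunctor (ModuleCat.{u} R) 0).obj (ModuleCat.of R T)

/-- The aisle `U = {X : Hom(T[i], X) = 0 for i < 0}` of the `t`-structure induced by `T`. -/
def aisleSet (T : Type u) [AddCommGroup T] [Module R T] :
    Set (DerivedCategory (ModuleCat.{u} R)) :=
  {X | ∀ i : ℤ, i < 0 → ∀ f : (singleT R T)⟦i⟧ ⟶ X, f = 0}

/-- The heart `H = {X : Hom(T[i], X) = 0 for i ≠ 0}` of the `t`-structure induced by `T`. -/
def heartSet (T : Type u) [AddCommGroup T] [Module R T] :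
    Set (DerivedCategory (ModuleCat.{u} R)) :=
  {X | ∀ i : ℤ, i ≠ 0 → ∀ f : (singleT R T)⟦i⟧ ⟶ X, f = 0}

end Derived

section HomExactness

open CochainComplex HomComplex

variable {C : Type*} [Category C] [Abelian C]

/-- The complex `Hom(M, Y)` is exact in degree `j`. -/
def HomExactAt (M : C) (Y : CochainComplex C ℤ) (j : ℤ) : Prop :=
  ∀ a : M ⟶ Y.X j, a ≫ Y.d j (j + 1) = 0 → ∃ b : M ⟶ Y.X (j - 1), b ≫ Y.d (j - 1) j = a

/-- The map `Hom(M, K) → Hom(M, L)` induced by `φ` is a quasi-isomorphism. -/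
structure HomQuasiIso {K L : CochainComplex C ℤ} (M : C) (φ : K ⟶ L) : Prop where
  inj : ∀ {i j k : ℤ}, i + 1 = j → j + 1 = k → ∀ (b : M ⟶ K.X j) (c : M ⟶ L.X i),
    b ≫ K.d j k = 0 → b ≫ φ.f j = c ≫ L.d i j → ∃ b' : M ⟶ K.X i, b' ≫ K.d i j = b
  surj : ∀ {i j k : ℤ}, i + 1 = j → j + 1 = k → ∀ a : M ⟶ L.X j, a ≫ L.d j k = 0 →
    ∃ (b : M ⟶ K.X j) (c : M ⟶ L.X i), b ≫ K.d j k = 0 ∧ a = b ≫ φ.f j + c ≫ L.d i j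

lemma HomExactAt.exists_lift {M : C} {Y : CochainComplex C ℤ} {j : ℤ} (h : HomExactAt M Y j)
    {i k : ℤ} (hi : i + 1 = j) (hk : j + 1 = k) (a : M ⟶ Y.X j) (ha : a ≫ Y.d j k = 0) :
    ∃ b : M ⟶ Y.X i, b ≫ Y.d i j = a := by
  obtain rfl : i = j - 1 := by lia
  subst hk
  exact h a ha

lemma homExactAt_mappingCone {K L : CochainComplex C ℤ} {M : C} {φ : K ⟶ L}
    (h : HomQuasiIso M φ) (j : ℤ) : HomExactAt M (mappingCone φ) j := by
  intro a ha
  obtain ⟨x, y, rfl⟩ := mappingCone.decomp_to φ a (j + 1) rfl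
  have h1 := ha =≫ (mappingCone.fst φ).1.v (j + 1) (j + 2) (by lia)
  have h2 := ha =≫ (mappingCone.snd φ).v (j + 1) (j + 1) (by lia)
  simp only [Category.assoc, mappingCone.d_fst_v φ j (j + 1) (j + 2) rfl (by lia),
    mappingCone.d_snd_v φ j (j + 1) rfl, zero_comp, Preadditive.add_comp, Preadditive.comp_add,
    Preadditive.comp_neg, mappingCone.inl_v_fst_v_assoc,
    mappingCone.inr_f_fst_v_assoc, mappingCone.inl_v_snd_v_assoc, mappingCone.inr_f_snd_v_assoc,
    comp_zero, add_zero, zero_add, neg_eq_zero, neg_zero] at h1 h2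
  obtain ⟨x', hx'⟩ := h.inj rfl (by lia) x (-y) h1 (by
    rw [Preadditive.neg_comp]; exact eq_neg_of_add_eq_zero_left h2)
  obtain ⟨b, c, hb, hc⟩ := h.surj (i := j - 1) (by lia) rfl (y + x' ≫ φ.f j) (by
    simp [reassoc_of% hx', ← h2, add_comm])
  refine ⟨(b - x') ≫ (mappingCone.inl φ).v j (j - 1) (by lia) + c ≫ (mappingCone.inr φ).f (j - 1),
    ?_⟩
  apply mappingCone.ext_to φ j (j + 1) rfl
  · simp [mappingCone.d_fst_v φ (j - 1) j (j + 1) (by lia) (by lia), hb, hx']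
  · simp [mappingCone.d_snd_v φ (j - 1) j (by lia)]
    rw [← sub_eq_zero] at hc ⊢
    rw [← neg_eq_zero, ← hc]
    abel

lemma homQuasiIso_of_mappingCone {K L : CochainComplex C ℤ} {M : C} {φ : K ⟶ L}
    (h : ∀ j, HomExactAt M (mappingCone φ) j) : HomQuasiIso M φ where
  inj {i j k} hij hjk b c hb hbc := by
    obtain ⟨a, ha⟩ := (h i).exists_lift (i := i - 1) (by lia) hij
      (b ≫ (mappingCone.inl φ).v j i (by lia) - c ≫ (mappingCone.inr φ).f i) (by
        apply mappingCone.ext_to φ j k hjk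
        · simp [mappingCone.d_fst_v φ i j k hij hjk, hb]
        · simp [mappingCone.d_snd_v φ i j hij, hbc])
    refine ⟨- a ≫ (mappingCone.fst φ).1.v (i - 1) i (by lia), ?_⟩
    have := ha =≫ (mappingCone.fst φ).1.v i j hij
    simpa [mappingCone.d_fst_v φ (i - 1) i j (by lia) hij] using this
  surj {i j k} hij hjk a ha := by
    obtain ⟨e, he⟩ := (h j).exists_lift hij hjk (a ≫ (mappingCone.inr φ).f j) (by
      simp [reassoc_of% ha])
    have h1 := he =≫ (mappingCone.fst φ).1.v j k hjk
    have h2 := he =≫ (mappingCone.snd φ).v j j (by lia)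
    simp only [Category.assoc, mappingCone.d_fst_v φ i j k hij hjk,
      mappingCone.d_snd_v φ i j hij, Preadditive.comp_add, Preadditive.comp_neg,
      mappingCone.inr_f_fst_v, mappingCone.inr_f_snd_v, comp_zero,
      neg_eq_zero, Category.comp_id] at h1 h2
    exact ⟨e ≫ (mappingCone.fst φ).1.v i j hij, e ≫ (mappingCone.snd φ).v i i (by lia),
      by simpa using h1, by simpa using h2.symm⟩

lemma acyclic_mappingCone_iff {K L : CochainComplex C ℤ} (φ : K ⟶ L) :
    (mappingCone φ).Acyclic ↔ QuasiIso φ := by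
  have h := (HomotopyCategory.subcategoryAcyclic C).trW_iff_of_distinguished _
    (HomotopyCategory.mappingCone_triangleh_distinguished φ)
  rw [← HomotopyCategory.quasiIso_eq_trW_subcategoryAcyclic] at h
  rw [← HomologicalComplex.mem_quasiIso_iff, ← HomotopyCategory.quotient_map_mem_quasiIso_iff]
  exact ((HomotopyCategory.quotient_obj_mem_subcategoryAcyclic_iff_acyclic _).symm.trans h.symm)

lemma shortExact_kernel_of_exact {S : ShortComplex C} (hS : S.Exact) :
    (ShortComplex.mk (kernel.ι S.f) (kernel.lift S.g S.f S.zero) (by ext; simp)).ShortExact where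
  exact := ShortComplex.exact_of_f_is_kernel _ <| KernelFork.IsLimit.ofι' _ _ fun k hk ↦
    ⟨kernel.lift _ k (by simpa using hk =≫ kernel.ι _), kernel.lift_ι _ _ _⟩
  epi_g := hS.epi_kernelLift

lemma shortExact_kernel_of_acyclic {Y : CochainComplex C ℤ} (hY : Y.Acyclic) (i : ℤ) :
    (ShortComplex.mk (kernel.ι (Y.d i (i + 1)))
      (kernel.lift (Y.d (i + 1) (i + 1 + 1)) (Y.d i (i + 1)) (by simp)) (by
        ext; simp)).ShortExact :=
  shortExact_kernel_of_exact
    ((HomologicalComplex.exactAt_iff' Y i (i + 1) (i + 1 + 1) (by simp) (by simp)).1 (hY (i + 1)))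

end HomExactness

section Module

variable {R : Type u} [Ring R]

lemma acyclic_of_homExactAt {Y : CochainComplex (ModuleCat.{u} R) ℤ}
    (h : ∀ j, HomExactAt (ModuleCat.of R R) Y j) : Y.Acyclic := by
  intro j
  rw [HomologicalComplex.exactAt_iff' Y (j - 1) j (j + 1) (by simp) (by simp),
    ShortComplex.moduleCat_exact_iff]
  intro x hx
  obtain ⟨b, hb⟩ := h j (ModuleCat.ofHom (LinearMap.toSpanSingleton R _ x)) (by
    ext
    exact (congrArg _ (one_smul R x)).trans hx)
  exact ⟨b (1 : R), congr($hb (1 : R)).trans (one_smul R x)⟩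

lemma quasiIso_of_homQuasiIso {K L : CochainComplex (ModuleCat.{u} R) ℤ} {φ : K ⟶ L}
    (h : HomQuasiIso (ModuleCat.of R R) φ) : QuasiIso φ :=
  (acyclic_mappingCone_iff φ).1 (acyclic_of_homExactAt (homExactAt_mappingCone h))

end Module

section ExtVanishing

open CochainComplex HomComplex

variable {C : Type*} [Category C] [Abelian C] [HasExt.{w} C]

/-- `Ext^i(M, X) = 0` for all `i > d`. -/
def ExtVanishAbove (d : ℕ) (M X : C) : Prop :=
  ∀ i, d < i → Subsingleton (Abelian.Ext.{w} M X i)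

open Abelian

lemma ExtVanishAbove.mono {d d' : ℕ} {M X : C} (h : ExtVanishAbove.{w} d M X) (hd : d ≤ d') :
    ExtVanishAbove.{w} d' M X :=
  fun i hi ↦ h i (hd.trans_lt hi)

lemma extVanishAbove_zero_of_injective (M X : C) [Injective X] : ExtVanishAbove.{w} 0 M X := by
  intro i hi
  obtain ⟨i, rfl⟩ := Nat.exists_eq_add_of_lt hi
  exact Ext.subsingleton_of_injective ..

lemma extVanishAbove_zero_of_projective (M X : C) [Projective M] : ExtVanishAbove.{w} 0 M X := by
  intro i hi
  obtain ⟨i, rfl⟩ := Nat.exists_eq_add_of_lt hi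
  exact Ext.subsingleton_of_projective ..

lemma ExtVanishAbove.of_id_eq_add {d : ℕ} {M X Y Z : C} {a : X ⟶ Y} {b : Y ⟶ X} {a' : X ⟶ Z}
    {b' : Z ⟶ X} (h : a ≫ b + a' ≫ b' = 𝟙 X) (hY : ExtVanishAbove.{w} d M Y)
    (hZ : ExtVanishAbove.{w} d M Z) : ExtVanishAbove.{w} d M X := by
  refine fun i hi ↦ subsingleton_of_forall_eq 0 fun x ↦ ?_
  have := hY i hi
  have := hZ i hi
  rw [← x.comp_mk₀_id, ← h, Ext.mk₀_add, Ext.comp_add, ← Ext.mk₀_comp_mk₀, ← Ext.mk₀_comp_mk₀,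
    ← Ext.comp_assoc_of_third_deg_zero, ← Ext.comp_assoc_of_third_deg_zero,
    Subsingleton.elim (x.comp (Ext.mk₀ a) (add_zero i)) 0,
    Subsingleton.elim (x.comp (Ext.mk₀ a') (add_zero i)) 0]
  simp

lemma ExtVanishAbove.of_retract {d : ℕ} {M X Y : C} {a : X ⟶ Y} {b : Y ⟶ X} (h : a ≫ b = 𝟙 X)
    (hY : ExtVanishAbove.{w} d M Y) : ExtVanishAbove.{w} d M X :=
  of_id_eq_add (by rw [h, zero_comp, add_zero]) hY (a' := 0) (b' := 0) hY

lemma ExtVanishAbove.of_retract_left {d : ℕ} {M N X : C} {a : M ⟶ N} {b : N ⟶ M}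
    (h : a ≫ b = 𝟙 M) (hN : ExtVanishAbove.{w} d N X) : ExtVanishAbove.{w} d M X := by
  refine fun i hi ↦ subsingleton_of_forall_eq 0 fun x ↦ ?_
  have := hN i hi
  rw [← x.mk₀_id_comp, ← h, ← Ext.mk₀_comp_mk₀_assoc,
    Subsingleton.elim ((Ext.mk₀ b).comp x (zero_add i)) 0]
  simp

lemma ExtVanishAbove.X₃ {d : ℕ} {M : C} {S : ShortComplex C} (hS : S.ShortExact)
    (h₁ : ExtVanishAbove.{w} (d + 1) M S.X₁) (h₂ : ExtVanishAbove.{w} d M S.X₂) :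
    ExtVanishAbove.{w} d M S.X₃ := by
  refine fun i hi ↦ subsingleton_of_forall_eq 0 fun x ↦ ?_
  have := h₁ (i + 1) (by lia)
  have := h₂ i hi
  obtain ⟨y, rfl⟩ := Ext.covariant_sequence_exact₃ M hS x rfl (Subsingleton.elim _ _)
  rw [Subsingleton.elim y 0, Ext.zero_comp]

lemma ExtVanishAbove.X₁_left {d : ℕ} {X : C} {S : ShortComplex C} (hS : S.ShortExact)
    (h₂ : ExtVanishAbove.{w} d S.X₂ X) (h₃ : ExtVanishAbove.{w} (d + 1) S.X₃ X) :
    ExtVanishAbove.{w} d S.X₁ X := by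
  refine fun i hi ↦ subsingleton_of_forall_eq 0 fun x ↦ ?_
  have := h₂ i hi
  have := h₃ (1 + i) (by lia)
  obtain ⟨y, rfl⟩ := Ext.contravariant_sequence_exact₁ hS X x rfl (Subsingleton.elim _ _)
  rw [Subsingleton.elim y 0, Ext.comp_zero]

lemma exists_lift_of_subsingleton_ext {M : C} {S : ShortComplex C} (hS : S.ShortExact)
    [Subsingleton (Ext.{w} M S.X₁ 1)] (a : M ⟶ S.X₃) : ∃ b : M ⟶ S.X₂, b ≫ S.g = a := by
  obtain ⟨y, hy⟩ := Ext.covariant_sequence_exact₃ M hS (Ext.mk₀ a) (zero_add 1)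
    (Subsingleton.elim _ _)
  refine ⟨Ext.homEquiv₀ y, (Ext.mk₀_bijective _ _).1 ?_⟩
  rw [← hy, ← Ext.mk₀_comp_mk₀, Ext.mk₀_homEquiv₀_apply]

lemma exists_extension_of_subsingleton_ext {X : C} {S : ShortComplex C} (hS : S.ShortExact)
    [Subsingleton (Ext.{w} S.X₃ X 1)] (a : S.X₁ ⟶ X) : ∃ b : S.X₂ ⟶ X, S.f ≫ b = a := by
  obtain ⟨y, hy⟩ := Ext.contravariant_sequence_exact₁ hS X (Ext.mk₀ a) (add_zero 1)
    (Subsingleton.elim _ _)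
  refine ⟨Ext.homEquiv₀ y, (Ext.mk₀_bijective _ _).1 ?_⟩
  rw [← hy, ← Ext.mk₀_comp_mk₀, Ext.mk₀_homEquiv₀_apply]

lemma ExtVanishAbove.mappingCone {d : ℕ} {M : C} {K L : CochainComplex C ℤ} (φ : K ⟶ L)
    (hK : ∀ k, ExtVanishAbove.{w} d M (K.X k)) (hL : ∀ k, ExtVanishAbove.{w} d M (L.X k)) (k : ℤ) :
    ExtVanishAbove.{w} d M ((mappingCone φ).X k) :=
  .of_id_eq_add (mappingCone.id_X φ k (k + 1) rfl) (hK _) (hL _)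

/-- If `Y` is an acyclic complex with terms in `M^⊥` and `M` has finite projective dimension,
then `Hom(M, Y)` is acyclic. -/
lemma homExactAt_of_acyclic_of_extVanishAbove {M : C} {n : ℕ}
    (hM : ∀ X, ExtVanishAbove.{w} n M X) {Y : CochainComplex C ℤ} (hY : Y.Acyclic)
    (hY' : ∀ k, ExtVanishAbove.{w} 0 M (Y.X k)) (j : ℤ) : HomExactAt M Y j := by
  have key : ∀ d, (∀ i, ExtVanishAbove.{w} d M (kernel (Y.d i (i + 1)))) →
      ∀ i, ExtVanishAbove.{w} 0 M (kernel (Y.d i (i + 1))) := by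
    intro d
    induction d with
    | zero => exact id
    | succ d hd =>
      refine fun h ↦ hd fun i ↦ ?_
      obtain ⟨i, rfl⟩ : ∃ i', i = i' + 1 := ⟨i - 1, by lia⟩
      exact .X₃ (shortExact_kernel_of_acyclic hY i) (h i) ((hY' i).mono (Nat.zero_le d))
  obtain ⟨i, rfl⟩ : ∃ i, j = i + 1 := ⟨j - 1, by lia⟩
  intro a ha
  have := key n (fun i ↦ hM _) i 1 one_pos
  obtain ⟨b, hb⟩ := exists_lift_of_subsingleton_ext (shortExact_kernel_of_acyclic hY i)
    (kernel.lift _ a ha)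
  dsimp at hb
  rw [← eq_sub_of_add_eq (rfl : i + 1 = i + 1)]
  exact ⟨b, by simpa using hb =≫ kernel.ι _⟩

end ExtVanishing

lemma subsingleton_ext_of_extVanish {R : Type u} [Ring R] {n : ℕ} {M X : ModuleCat.{u} R}
    (hn : 0 < n) (h : ExtVanish R n M X) : Subsingleton (Abelian.Ext.{u} M X n) := by
  let P := projectiveResolution M
  have h0 : IsZero ((P.complex.linearYonedaObj ℤ X).homology n) := by
    rw [ExtVanish] at h
    exact (ModuleCat.isZero_of_subsingleton _).of_iso (P.isoExt n X).symm
  obtain ⟨n, rfl⟩ : ∃ m, n = m + 1 := ⟨n - 1, by lia⟩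
  rw [← HomologicalComplex.exactAt_iff_isZero_homology,
    HomologicalComplex.exactAt_iff' _ n (n + 1) (n + 2) (by simp) (by simp),
    ShortComplex.moduleCat_exact_iff] at h0
  refine subsingleton_of_forall_eq 0 fun x ↦ ?_
  obtain ⟨f, hf, rfl⟩ := P.extMk_surjective x (n + 2) rfl
  rw [P.extMk_eq_zero_iff _ _ _ _ n rfl]
  exact h0 f hf

section Resolution

open CochainComplex HomComplex

variable {C : Type*} [Category C] [Abelian C]

lemma mappingCocone_ext_to {K L : CochainComplex C ℤ} (φ : K ⟶ L) {i j : ℤ} (hij : i + 1 = j)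
    {A : C} {f g : A ⟶ (mappingCocone φ).X j}
    (h₁ : f ≫ (mappingCocone.fst φ).f j = g ≫ (mappingCocone.fst φ).f j)
    (h₂ : f ≫ (mappingCocone.snd φ).v j i (by lia) = g ≫ (mappingCocone.snd φ).v j i (by lia)) :
    f = g := by
  rw [← Category.comp_id f, ← Category.comp_id g, ← mappingCocone.id_X φ j i (by lia),
    Preadditive.comp_add, Preadditive.comp_add, reassoc_of% h₁, reassoc_of% h₂]

lemma mappingCocone_d_snd {K L : CochainComplex C ℤ} (φ : K ⟶ L) {i j k : ℤ} (hij : i + 1 = j)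
    (hjk : j + 1 = k) :
    (mappingCocone φ).d j k ≫ (mappingCocone.snd φ).v k j (by lia) =
      -(mappingCocone.fst φ).f j ≫ φ.f j - (mappingCocone.snd φ).v j i (by lia) ≫ L.d i j := by
  have h : mappingCocone.snd φ =
      mappingCocone.descCochain φ 0 (Cochain.ofHom (𝟙 L)) (neg_add_cancel 1) := by
    ext p q hpq
    have := mappingCocone.id_X φ p q hpq =≫
      (mappingCocone.descCochain φ 0 (Cochain.ofHom (𝟙 L)) (neg_add_cancel 1)).v p q hpq
    simpa using this
  have h' := Cochain.congr_v (mappingCocone.δ_descCochain φ 0 (Cochain.ofHom (𝟙 L))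
    (neg_add_cancel 1) 1 (zero_add 1)) j j (add_zero j)
  rw [← h, δ_v (-1) 0 (neg_add_cancel 1) _ j j _ i k (by lia) hjk] at h'
  simp at h'
  rw [← h']
  abel

lemma homQuasiIso_lift {S : ShortComplex (CochainComplex C ℤ)} (hS : S.ShortExact) {P : C}
    [Projective P] :
    HomQuasiIso P (mappingCocone.lift S.g S.f (0 : Cochain S.X₁ S.X₃ (-1)) (by simp)) := by
  have hS' (i : ℤ) : (S.map (HomologicalComplex.eval C (ComplexShape.up ℤ) i)).ShortExact :=
    hS.map_of_exact _
  have hι (i : ℤ) : Mono (S.f.f i) := (hS' i).mono_f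
  have lift {i : ℤ} (z : P ⟶ S.X₃.X i) : ∃ e : P ⟶ S.X₂.X i, e ≫ S.g.f i = z :=
    have : Epi (S.g.f i) := (hS' i).epi_g
    ⟨Projective.factorThru z (S.g.f i), Projective.factorThru_comp _ _⟩
  have lift' {i : ℤ} (z : P ⟶ S.X₂.X i) (hz : z ≫ S.g.f i = 0) :
      ∃ e : P ⟶ S.X₁.X i, e ≫ S.f.f i = z :=
    ⟨(hS' i).exact.liftFromProjective z hz, (hS' i).exact.liftFromProjective_comp z hz⟩
  constructor
  · intro i j k hij hjk b c hb hbc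
    have h1 := hbc =≫ (mappingCocone.fst S.g).f j
    have h2 := hbc =≫ (mappingCocone.snd S.g).v j i (by lia)
    simp only [Category.assoc, mappingCocone.lift_f_fst_f, mappingCocone.lift_f_snd_v,
      Cochain.zero_v, comp_zero, mappingCocone_d_snd S.g (i := i - 1) (by lia) hij,
      ← HomologicalComplex.Hom.comm] at h1 h2
    obtain ⟨e, he⟩ := lift (c ≫ (mappingCocone.snd S.g).v i (i - 1) (by lia))
    obtain ⟨b', hb'⟩ := lift' (c ≫ (mappingCocone.fst S.g).f i + e ≫ S.X₂.d (i - 1) i) (by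
      simp only [Preadditive.add_comp, Category.assoc, ← S.g.comm, reassoc_of% he]
      rw [Preadditive.comp_sub, Preadditive.comp_neg] at h2
      rw [← neg_eq_zero, h2]
      abel)
    refine ⟨b', ?_⟩
    rw [← cancel_mono (S.f.f j), Category.assoc, ← S.f.comm, reassoc_of% hb', h1]
    simp
  · intro i j k hij hjk a ha
    have h1 := ha =≫ (mappingCocone.fst S.g).f k
    have h2 := ha =≫ (mappingCocone.snd S.g).v k j (by lia)
    simp only [Category.assoc, zero_comp, mappingCocone_d_snd S.g hij hjk,
      ← HomologicalComplex.Hom.comm] at h1 h2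
    obtain ⟨e, he⟩ := lift (a ≫ (mappingCocone.snd S.g).v j i (by lia))
    obtain ⟨b, hb⟩ := lift' (a ≫ (mappingCocone.fst S.g).f j + e ≫ S.X₂.d i j) (by
      simp only [Preadditive.add_comp, Category.assoc, ← S.g.comm, reassoc_of% he]
      rw [Preadditive.comp_sub, Preadditive.comp_neg] at h2
      rw [← neg_eq_zero, ← h2]
      abel)
    refine ⟨b, -e ≫ (mappingCocone.inl S.g).v i i (add_zero i), ?_, ?_⟩
    · rw [← cancel_mono (S.f.f k), Category.assoc, ← S.f.comm, reassoc_of% hb]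
      simp [reassoc_of% ha]
    · apply mappingCocone_ext_to S.g hij
      · simp [hb, -HomologicalComplex.Hom.comm, ← HomologicalComplex.Hom.comm]
      · simp [mappingCocone_d_snd S.g (i := i - 1) (by lia) hij, he]

variable [HasExt.{w} C] [EnoughInjectives C]

lemma exists_homQuasiIso_of_succ {M : C} {d : ℕ} (X : CochainComplex C ℤ)
    (hX : ∀ k, ExtVanishAbove.{w} (d + 1) M (X.X k)) :
    ∃ (Y : CochainComplex C ℤ) (s : X ⟶ Y), (∀ k, ExtVanishAbove.{w} d M (Y.X k)) ∧
      ∀ (P : C) [Projective P], HomQuasiIso P s := by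
  let ι : X ⟶ mappingCone (𝟙 (cm5b.I X)) := cm5b.i (𝟙 X) ≫ biprod.fst
  have hι (n : ℤ) : Mono (ι.f n) := by
    have := cm5b.i_f_comp (𝟙 X) n
    rw [← Category.assoc] at this
    exact @mono_of_mono_fac _ _ _ _ _ _ _ _ (Injective.ι_mono _) this
  have : Mono ι := HomologicalComplex.mono_of_mono_f ι hι
  let S := ShortComplex.mk ι (cokernel.π ι) (cokernel.condition ι)
  have hS : S.ShortExact :=
    { exact := ShortComplex.exact_of_g_is_cokernel _ (cokernelIsCokernel ι) }
  have hE (k : ℤ) : ExtVanishAbove.{w} 0 M (S.X₂.X k) := extVanishAbove_zero_of_injective _ _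
  have hS' (i : ℤ) : (S.map (HomologicalComplex.eval C (ComplexShape.up ℤ) i)).ShortExact :=
    hS.map_of_exact _
  refine ⟨mappingCocone S.g, mappingCocone.lift S.g S.f 0 (by simp), fun k ↦ ?_,
    fun P _ ↦ homQuasiIso_lift hS⟩
  exact .of_id_eq_add (mappingCocone.id_X S.g k (k - 1) (by lia)) ((hE k).mono (Nat.zero_le d))
    (.X₃ (hS' _) (hX _) ((hE _).mono (Nat.zero_le d)))

end Resolution

/-- If `M` has finite projective dimension, then every complex of modules is quasi-isomorphic
to a complex with terms in `M^⊥`. -/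
lemma exists_quasiIso_extVanishAbove {R : Type u} [Ring R] {M : ModuleCat.{u} R} {n : ℕ}
    (X : CochainComplex (ModuleCat.{u} R) ℤ)
    (hX : ∀ k, ExtVanishAbove.{u} n M (X.X k)) :
    ∃ (Y : CochainComplex (ModuleCat.{u} R) ℤ) (s : X ⟶ Y), QuasiIso s ∧
      ∀ k, ExtVanishAbove.{u} 0 M (Y.X k) := by
  induction n generalizing X with
  | zero => exact ⟨X, 𝟙 X, inferInstance, hX⟩
  | succ n hn =>
    obtain ⟨Y, s, hY, hs⟩ := exists_homQuasiIso_of_succ X hX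
    obtain ⟨Z, t, ht, hZ⟩ := hn Y hY
    have := quasiIso_of_homQuasiIso (hs (ModuleCat.of R R))
    exact ⟨Z, s ≫ t, inferInstance, hZ⟩

section SingleHom

open CochainComplex.HomComplex

variable {C : Type*} [Category C] [Abelian C]

lemma exists_homotopy_zero_iff {M : C} {Y : CochainComplex C ℤ} {i j k : ℤ} (hij : i + 1 = j)
    (hjk : j + 1 = k) (a : M ⟶ Y.X j) (ha : ∀ k, (ComplexShape.up ℤ).Rel j k → a ≫ Y.d j k = 0) :
    Nonempty (Homotopy (HomologicalComplex.mkHomFromSingle a ha) 0) ↔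
      ∃ b : M ⟶ Y.X i, b ≫ Y.d i j = a := by
  constructor
  · rintro ⟨H⟩
    refine ⟨(HomologicalComplex.singleObjXSelf _ j M).inv ≫ H.hom j i, ?_⟩
    have := H.comm j
    rw [dNext_eq _ (show (ComplexShape.up ℤ).Rel j k from hjk),
      prevD_eq _ (show (ComplexShape.up ℤ).Rel i j from hij)] at this
    simpa [HomologicalComplex.mkHomFromSingle_f] using
      ((HomologicalComplex.singleObjXSelf _ j M).inv ≫= this).symm
  · rintro ⟨b, rfl⟩
    let g : (CochainComplex.singleFunctor C j).obj M ⟶ Y :=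
      HomologicalComplex.mkHomFromSingle (b ≫ Y.d i j) ha
    have hg : Cochain.ofHom g = Cochain.fromSingleMk (b ≫ Y.d i j) (add_zero j) := by
      apply (Cochain.fromSingleEquiv (add_zero j)).injective
      rw [Cochain.fromSingleEquiv_fromSingleMk]
      exact (Iso.inv_comp_eq _).2 ((Cochain.ofHom_v g j).trans
        (HomologicalComplex.mkHomFromSingle_f _ _))
    have H : Homotopy g 0 := (Cochain.equivHomotopy g 0).symm
      ⟨.fromSingleMk b (n := -1) (by lia), by
        rw [hg, Cochain.δ_fromSingleMk b (by lia) 0 j (add_zero j), Cochain.ofHom_zero, add_zero]⟩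
    exact ⟨H⟩

end SingleHom

section DerivedHom

variable {R : Type u} [Ring R] {M : ModuleCat.{u} R} {n : ℕ}

lemma homQuasiIso_of_quasiIso (hM : ∀ X, ExtVanishAbove.{u} n M X)
    {Y Y' : CochainComplex (ModuleCat.{u} R) ℤ} (hY : ∀ k, ExtVanishAbove.{u} 0 M (Y.X k))
    (hY' : ∀ k, ExtVanishAbove.{u} 0 M (Y'.X k)) (s : Y ⟶ Y') [QuasiIso s] : HomQuasiIso M s :=
  homQuasiIso_of_mappingCone fun j ↦ homExactAt_of_acyclic_of_extVanishAbove hM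
    ((acyclic_mappingCone_iff s).2 inferInstance) (.mappingCone s hY hY') j

open DerivedCategory

variable [HasDerivedCategory.{w} (ModuleCat.{u} R)]

lemma derivedCategory_hom_eq_zero (hM : ∀ X, ExtVanishAbove.{u} n M X)
    {Y : CochainComplex (ModuleCat.{u} R) ℤ} (hY : ∀ k, ExtVanishAbove.{u} 0 M (Y.X k)) {j : ℤ}
    (h : HomExactAt M Y j)
    (φ : Q.obj ((HomologicalComplex.single _ _ j).obj M) ⟶ Q.obj Y) : φ = 0 := by
  obtain ⟨Y', g, s, hs, rfl⟩ := left_fac φ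
  rw [isIso_Q_map_iff_quasiIso] at hs
  obtain ⟨Y'', t, ht, hY''⟩ := exists_quasiIso_extVanishAbove Y' fun _ ↦ hM _
  let a : M ⟶ Y''.X j := (HomologicalComplex.singleObjXSelf _ j M).inv ≫ (g ≫ t).f j
  have ha : ∀ k, (ComplexShape.up ℤ).Rel j k → a ≫ Y''.d j k = 0 := fun k _ ↦ by simp [a]
  obtain ⟨b, c, hb, hc⟩ := (homQuasiIso_of_quasiIso hM hY hY'' (s ≫ t)).surj (sub_add_cancel j 1)
    rfl a (ha _ rfl)
  obtain ⟨e, rfl⟩ := h b hb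
  obtain ⟨H⟩ := (exists_homotopy_zero_iff (sub_add_cancel j 1) rfl a ha).2
    ⟨e ≫ (s ≫ t).f _ + c, by simp [hc]⟩
  have hgt : g ≫ t = HomologicalComplex.mkHomFromSingle a ha := by
    apply HomologicalComplex.from_single_hom_ext
    simp [a, HomologicalComplex.mkHomFromSingle_f]
  have := Q_map_eq_of_homotopy _ H
  rw [← hgt, Functor.map_comp, Functor.map_zero] at this
  have hg : Q.map g = 0 := by rw [← cancel_mono (Q.map t), this, zero_comp]
  rw [hg, zero_comp]

lemma homExactAt_of_derivedCategory_hom_eq_zero (hM : ∀ X, ExtVanishAbove.{u} n M X)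
    {Y : CochainComplex (ModuleCat.{u} R) ℤ} (hY : ∀ k, ExtVanishAbove.{u} 0 M (Y.X k)) {j : ℤ}
    (h : ∀ φ : Q.obj ((HomologicalComplex.single _ _ j).obj M) ⟶ Q.obj Y, φ = 0) :
    HomExactAt M Y j := by
  intro a ha
  have ha' : ∀ k, (ComplexShape.up ℤ).Rel j k → a ≫ Y.d j k = 0 := by rintro _ rfl; exact ha
  let g := HomologicalComplex.mkHomFromSingle a ha'
  have hg : Qh.map ((HomotopyCategory.quotient _ _).map g) =
      Qh.map ((HomotopyCategory.quotient _ _).map 0) :=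
    (h (Q.map g)).trans (h (Q.map 0)).symm
  rw [MorphismProperty.map_eq_iff_postcomp Qh (HomotopyCategory.quasiIso _ _)] at hg
  obtain ⟨Z, s, hs, hgs⟩ := hg
  obtain ⟨Z, rfl⟩ := HomotopyCategory.quotient_obj_surjective Z
  obtain ⟨s, rfl⟩ := (HomotopyCategory.quotient _ _).map_surjective s
  rw [HomotopyCategory.quotient_map_mem_quasiIso_iff, HomologicalComplex.mem_quasiIso_iff] at hs
  obtain ⟨Y', t, ht, hY'⟩ := exists_quasiIso_extVanishAbove Z fun _ ↦ hM _
  rw [← Functor.map_comp, ← Functor.map_comp] at hgs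
  have H := (HomotopyCategory.homotopyOfEq _ _ hgs).compRight t
  have ha'' : ∀ k, (ComplexShape.up ℤ).Rel j k → (a ≫ (s ≫ t).f j) ≫ Y'.d j k = 0 := by
    intro k hk
    simp [reassoc_of% (ha' k hk)]
  have hgt : (g ≫ s) ≫ t = HomologicalComplex.mkHomFromSingle _ ha'' := by
    apply HomologicalComplex.from_single_hom_ext
    simp [g, HomologicalComplex.mkHomFromSingle_f]
  rw [hgt, zero_comp, zero_comp] at H
  obtain ⟨c, hc⟩ := (exists_homotopy_zero_iff (sub_add_cancel j 1) rfl _ ha'').1 ⟨H⟩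
  exact (homQuasiIso_of_quasiIso hM hY hY' (s ≫ t)).inj (sub_add_cancel j 1) rfl a c ha hc.symm

end DerivedHom

section Tilting

variable {R : Type u} [Ring R] {n : ℕ} {T : Type u} [AddCommGroup T] [Module R T]

lemma IsNTilting.extVanishAbove (hT : IsNTilting R n T) (X : ModuleCat.{u} R) :
    ExtVanishAbove.{u} n (ModuleCat.of R T) X :=
  fun i hi ↦ subsingleton_ext_of_extVanish (by lia) (hT.1 X i hi)

lemma IsNTilting.extVanishAbove_of_memAddT (hT : IsNTilting R n T) {X : ModuleCat.{u} R}
    (hX : MemAddT R T X) : ExtVanishAbove.{u} 0 (ModuleCat.of R T) X := by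
  obtain ⟨κ, s, p, h⟩ := hX
  exact .of_retract (a := ModuleCat.ofHom s) (b := ModuleCat.ofHom p)
    (ModuleCat.hom_ext h) fun i hi ↦ subsingleton_ext_of_extVanish hi (hT.2.1 κ i hi)

variable [HasDerivedCategory.{w} (ModuleCat.{u} R)]

lemma mem_aisleSet_of_iso {X Y : DerivedCategory (ModuleCat.{u} R)} (e : X ≅ Y)
    (hX : X ∈ aisleSet R T) : Y ∈ aisleSet R T := fun i hi f ↦ by
  rw [← cancel_mono e.inv, hX i hi (f ≫ e.inv), zero_comp]

lemma IsNTilting.Q_mem_aisleSet_iff (hT : IsNTilting R n T)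
    {Y : CochainComplex (ModuleCat.{u} R) ℤ}
    (hY : ∀ k, ExtVanishAbove.{u} 0 (ModuleCat.of R T) (Y.X k)) :
    DerivedCategory.Q.obj Y ∈ aisleSet R T ↔ ∀ j, 0 < j → HomExactAt (ModuleCat.of R T) Y j := by
  have e (i : ℤ) : (singleT R T)⟦i⟧ ≅
      DerivedCategory.Q.obj ((HomologicalComplex.single _ _ (-i)).obj (ModuleCat.of R T)) :=
    ((DerivedCategory.singleFunctors (ModuleCat.{u} R)).shiftIso i (-i) 0
      (add_neg_cancel i)).app (ModuleCat.of R T)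
  refine ⟨fun h j hj ↦ homExactAt_of_derivedCategory_hom_eq_zero hT.extVanishAbove hY fun φ ↦ ?_,
    fun h i hi f ↦ ?_⟩
  · obtain ⟨i, rfl⟩ : ∃ i, j = -i := ⟨-j, by simp⟩
    rw [← cancel_epi (e i).hom, h i (by lia) ((e i).hom ≫ φ), comp_zero]
  · rw [← cancel_epi (e i).inv, comp_zero]
    exact derivedCategory_hom_eq_zero hT.extVanishAbove hY (h _ (by lia)) _

end Tilting

section Finsupp

variable {R : Type u} [Ring R] {T : Type u} [AddCommGroup T] [Module R T] {κ : Type u}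

/-- The inclusion of a copy of `T` in a direct sum of copies of `T`. -/
def finsuppι (k : κ) : ModuleCat.of R T ⟶ ModuleCat.of R (κ →₀ T) :=
  ModuleCat.ofHom (Finsupp.lsingle k)

/-- The map out of a direct sum of copies of `T` with given components. -/
def finsuppDesc {X : ModuleCat.{u} R} (g : κ → (ModuleCat.of R T ⟶ X)) :
    ModuleCat.of R (κ →₀ T) ⟶ X :=
  ModuleCat.ofHom (Finsupp.lsum ℕ fun k ↦ (g k).hom)

@[simp]
lemma finsuppι_desc {X : ModuleCat.{u} R} (g : κ → (ModuleCat.of R T ⟶ X)) (k : κ) :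
    finsuppι k ≫ finsuppDesc g = g k := by
  ext x
  exact Finsupp.sum_single_index (map_zero _)

lemma finsupp_hom_ext {X : ModuleCat.{u} R} {g h : ModuleCat.of R (κ →₀ T) ⟶ X}
    (H : ∀ k, finsuppι k ≫ g = finsuppι k ≫ h) : g = h :=
  ModuleCat.hom_ext (Finsupp.lhom_ext' fun k ↦ congr($(H k).hom))

end Finsupp

section Precover

variable {R : Type u} [Ring R] (T : Type u) [AddCommGroup T] [Module R T]
  (Y : CochainComplex (ModuleCat.{u} R) ℤ)

/-- A term `A` of a complex under construction, together with its maps to the next term `N` of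
that complex and to the term of degree `j` of `Y`. -/
structure PrecoverStage (j : ℤ) where
  A : ModuleCat.{u} R
  N : ModuleCat.{u} R
  f : A ⟶ Y.X j
  d : A ⟶ N

namespace PrecoverStage

variable {Y}

/-- The zero stage. -/
def zero (j : ℤ) : PrecoverStage Y j where
  A := ModuleCat.of R PUnit
  N := ModuleCat.of R PUnit
  f := 0
  d := 0

variable {j k : ℤ} (s : PrecoverStage Y k)

/-- The pairs of maps from `T` that have to factor through the stage preceding `s`. -/
def Index (j : ℤ) : Type u :=
  {p : (ModuleCat.of R T ⟶ s.A) × (ModuleCat.of R T ⟶ Y.X j) //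
    p.1 ≫ s.d = 0 ∧ p.1 ≫ s.f = p.2 ≫ Y.d j k}

/-- The canonical stage preceding `s`: a coproduct of copies of `T`. -/
def step (j : ℤ) : PrecoverStage Y j where
  A := ModuleCat.of R (s.Index T j →₀ T)
  N := s.A
  f := finsuppDesc fun p ↦ p.1.2
  d := finsuppDesc fun p ↦ p.1.1

lemma step_d_comp_d : (s.step T j).d ≫ s.d = 0 :=
  finsupp_hom_ext fun p ↦ (Category.assoc _ _ _).symm.trans
    ((finsuppι_desc _ p =≫ s.d).trans (p.2.1.trans comp_zero.symm))

lemma step_d_comp_f : (s.step T j).d ≫ s.f = (s.step T j).f ≫ Y.d j k :=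
  finsupp_hom_ext fun p ↦ (Category.assoc _ _ _).symm.trans
    ((finsuppι_desc _ p =≫ s.f).trans (p.2.2.trans
      ((finsuppι_desc (fun q : s.Index T j ↦ q.1.2) p =≫ Y.d j k).symm.trans (Category.assoc _ _ _))))

lemma exists_factor_step (a : ModuleCat.of R T ⟶ s.A) (b : ModuleCat.of R T ⟶ Y.X j)
    (h : a ≫ s.d = 0) (h' : a ≫ s.f = b ≫ Y.d j k) :
    ∃ c : ModuleCat.of R T ⟶ (s.step T j).A, c ≫ (s.step T j).d = a ∧ c ≫ (s.step T j).f = b :=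
  ⟨finsuppι (κ := s.Index T j) ⟨(a, b), h, h'⟩, finsuppι_desc _ _, finsuppι_desc _ _⟩

variable (Y)

/-- The stages of negative degree. -/
def negSucc : (n : ℕ) → PrecoverStage Y (Int.negSucc n)
  | 0 => ((zero 1).step T 0).step T (-1)
  | n + 1 => (negSucc n).step T _

/-- The stages of the canonical resolution of `Y` by a complex concentrated in degrees `≤ 0`. -/
def stage : (j : ℤ) → PrecoverStage Y j
  | .ofNat (_ + 1) => zero _
  | .ofNat 0 => (zero 1).step T 0
  | .negSucc n => negSucc T Y n

/-- The differential between consecutive stages. -/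
def stageD : (j : ℤ) → ((stage T Y j).A ⟶ (stage T Y (j + 1)).A)
  | .ofNat (_ + 1) => 0
  | .ofNat 0 => (stage T Y 0).d
  | .negSucc 0 => (negSucc T Y 0).d
  | .negSucc (n + 1) => (negSucc T Y (n + 1)).d

end PrecoverStage

lemma exists_precover_data : ∃ (A : ℤ → ModuleCat.{u} R) (d : ∀ j, A j ⟶ A (j + 1))
    (f : ∀ j, A j ⟶ Y.X j), (∀ j, 0 < j → IsZero (A j)) ∧ (∀ j, MemAddT R T (A j)) ∧
    (∀ j, d j ≫ d (j + 1) = 0) ∧ (∀ j, d j ≫ f (j + 1) = f j ≫ Y.d j (j + 1)) ∧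
    ∀ j, j ≤ 0 → ∀ (a : ModuleCat.of R T ⟶ A (j + 1)) (b : ModuleCat.of R T ⟶ Y.X j),
      a ≫ d (j + 1) = 0 → a ≫ f (j + 1) = b ≫ Y.d j (j + 1) →
      ∃ c : ModuleCat.of R T ⟶ A j, c ≫ d j = a ∧ c ≫ f j = b := by
  have hz (n : ℕ) : IsZero (PrecoverStage.stage T Y (.ofNat (n + 1))).A :=
    ModuleCat.isZero_of_subsingleton (ModuleCat.of R PUnit.{u + 1})
  refine ⟨fun j ↦ (PrecoverStage.stage T Y j).A, PrecoverStage.stageD T Y,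
    fun j ↦ (PrecoverStage.stage T Y j).f, ?_, ?_, ?_, ?_, ?_⟩
  · intro j hj
    obtain ⟨n, rfl⟩ : ∃ n : ℕ, j = .ofNat (n + 1) := ⟨(j - 1).toNat, by simp; lia⟩
    exact hz n
  · have hs {κ : Type u} : MemAddT R T (κ →₀ T) := ⟨κ, .id, .id, rfl⟩
    rintro ((_ | n) | (_ | n))
    · exact hs
    · exact ⟨PUnit, 0, 0, LinearMap.ext fun _ ↦ rfl⟩
    · exact hs
    · exact hs
  · rintro ((_ | n) | (_ | _ | n))
    · exact comp_zero
    · exact zero_comp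
    · exact PrecoverStage.step_d_comp_d T ((PrecoverStage.zero (Y := Y) 1).step T 0)
    · exact PrecoverStage.step_d_comp_d T (PrecoverStage.negSucc T Y 0)
    · exact PrecoverStage.step_d_comp_d T (PrecoverStage.negSucc T Y (n + 1))
  · rintro ((_ | n) | (_ | n))
    · exact PrecoverStage.step_d_comp_f T (PrecoverStage.zero 1)
    · exact (hz n).eq_of_src _ _
    · exact PrecoverStage.step_d_comp_f T ((PrecoverStage.zero (Y := Y) 1).step T 0)
    · exact PrecoverStage.step_d_comp_f T (PrecoverStage.negSucc T Y n)
  · rintro ((_ | n) | (_ | _ | n)) hj a b h h'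
    · exact PrecoverStage.exists_factor_step T (PrecoverStage.zero 1) a b comp_zero h'
    · simp at hj; lia
    · exact PrecoverStage.exists_factor_step T ((PrecoverStage.zero (Y := Y) 1).step T 0) a b h h'
    · exact PrecoverStage.exists_factor_step T (PrecoverStage.negSucc T Y 0) a b h h'
    · exact PrecoverStage.exists_factor_step T (PrecoverStage.negSucc T Y (n + 1)) a b h h'

lemma exists_homQuasiIso_memAddT (hY : ∀ j, 0 < j → HomExactAt (ModuleCat.of R T) Y j) :
    ∃ (Z : CochainComplex (ModuleCat.{u} R) ℤ) (φ : Z ⟶ Y), (∀ j, 0 < j → IsZero (Z.X j)) ∧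
      (∀ j, MemAddT R T (Z.X j)) ∧ HomQuasiIso (ModuleCat.of R T) φ := by
  obtain ⟨A, d, f, hA, hA', hd, hf, hc⟩ := exists_precover_data T Y
  let Z := CochainComplex.of A d hd
  have hZ (j : ℤ) : Z.d j (j + 1) = d j := CochainComplex.of_d ..
  let φ : Z ⟶ Y :=
    { f := f
      comm' := by
        rintro i _ rfl
        rw [hZ]
        exact (hf i).symm }
  refine ⟨Z, φ, hA, hA', ?_, ?_⟩
  · rintro i _ _ rfl rfl b c hb hbc
    rw [hZ] at hb
    rw [hZ]
    by_cases hi : i ≤ 0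
    · obtain ⟨b', hb', -⟩ := hc i hi b c hb hbc
      exact ⟨b', hb'⟩
    · exact ⟨0, (hA (i + 1) (by lia)).eq_of_tgt _ _⟩
  · rintro i j _ hij rfl a ha
    rw [hZ]
    by_cases hj : j ≤ 0
    · obtain ⟨b, hb, rfl⟩ := hc j hj 0 a zero_comp (by rw [ha, zero_comp])
      exact ⟨b, 0, hb, by rw [zero_comp, add_zero]⟩
    · obtain ⟨c, rfl⟩ := (hY j (by lia)).exists_lift hij rfl a ha
      exact ⟨0, c, zero_comp, by rw [zero_comp, zero_add]⟩

end Precover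

section HomAcyclic

variable {C : Type*} [Category C] [Abelian C] [HasExt.{w} C]

/-- The complex `Y` has terms in `M^⊥` and the complex `Hom(M, Y)` is acyclic. -/
structure HomAcyclic (M : C) (Y : CochainComplex C ℤ) : Prop where
  extVanishAbove : ∀ k, ExtVanishAbove.{w} 0 M (Y.X k)
  homExactAt : ∀ j, HomExactAt M Y j

namespace HomAcyclic

variable {Y : CochainComplex C ℤ}

lemma of_isZero {M : C} (hM : IsZero M) : HomAcyclic.{w} M Y where
  extVanishAbove _ :=
    have := hM.projective
    extVanishAbove_zero_of_projective _ _
  homExactAt _ _ _ := ⟨0, hM.eq_of_src _ _⟩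

lemma of_retract {M N : C} {s : M ⟶ N} {p : N ⟶ M} (h : s ≫ p = 𝟙 M) (hN : HomAcyclic.{w} N Y) :
    HomAcyclic.{w} M Y where
  extVanishAbove k := .of_retract_left h (hN.extVanishAbove k)
  homExactAt j a ha := by
    obtain ⟨b, hb⟩ := hN.homExactAt j (p ≫ a) (by rw [Category.assoc, ha, comp_zero])
    exact ⟨s ≫ b, by rw [Category.assoc, hb, reassoc_of% h]⟩

lemma X₁ {S : ShortComplex C} (hS : S.ShortExact) (h₂ : HomAcyclic.{w} S.X₂ Y)
    (h₃ : HomAcyclic.{w} S.X₃ Y) : HomAcyclic.{w} S.X₁ Y where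
  extVanishAbove k := .X₁_left hS (h₂.extVanishAbove k) ((h₃.extVanishAbove k).mono (Nat.zero_le 1))
  homExactAt j a ha := by
    have := h₃.extVanishAbove j 1 one_pos
    have := hS.epi_g
    obtain ⟨a', rfl⟩ := exists_extension_of_subsingleton_ext hS a
    obtain ⟨y, hy⟩ : ∃ y, S.g ≫ y = a' ≫ Y.d j (j + 1) :=
      ⟨hS.exact.desc _ (by rwa [Category.assoc] at ha), hS.exact.g_desc _ _⟩
    obtain ⟨v, rfl⟩ := (h₃.homExactAt (j + 1)).exists_lift rfl rfl y (by
      rw [← cancel_epi S.g, reassoc_of% hy, Y.d_comp_d, comp_zero, comp_zero])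
    obtain ⟨b, hb⟩ := h₂.homExactAt j (a' - S.g ≫ v) (by
      rw [Preadditive.sub_comp, Category.assoc, hy, sub_self])
    exact ⟨S.f ≫ b, by rw [Category.assoc, hb, Preadditive.comp_sub, S.zero_assoc, zero_comp,
      sub_zero]⟩

end HomAcyclic

end HomAcyclic

section Tilting

variable {R : Type u} [Ring R] {T : Type u} [AddCommGroup T] [Module R T]

lemma ExtVanishAbove.finsupp (κ : Type u) {X : ModuleCat.{u} R}
    (hX : ExtVanishAbove.{u} 0 (ModuleCat.of R T) X) :
    ExtVanishAbove.{u} 0 (ModuleCat.of R (κ →₀ T)) X := by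
  suffices ∀ (m : ℕ) (X : ModuleCat.{u} R), ExtVanishAbove.{u} 0 (ModuleCat.of R T) X →
      Subsingleton (Abelian.Ext.{u} (ModuleCat.of R (κ →₀ T)) X (m + 1)) by
    intro i hi
    obtain ⟨i, rfl⟩ := Nat.exists_eq_add_of_lt hi
    simpa using this (0 + i) X hX
  intro m
  induction m with (
    intro X hX
    let S := ShortComplex.mk (Injective.ι X) (cokernel.π _) (cokernel.condition _)
    have hS : S.ShortExact :=
      { exact := ShortComplex.exact_of_g_is_cokernel _ (cokernelIsCokernel _) }
    refine subsingleton_of_forall_eq 0 fun x ↦ ?_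
    obtain ⟨y, rfl⟩ := Abelian.Ext.covariant_sequence_exact₁ _ hS x
      (Abelian.Ext.eq_zero_of_injective _) rfl)
  | zero =>
    have := hX 1 one_pos
    choose b hb using fun k : κ ↦
      exists_lift_of_subsingleton_ext hS (finsuppι k ≫ Abelian.Ext.homEquiv₀ y)
    have hy : finsuppDesc b ≫ S.g = Abelian.Ext.homEquiv₀ y :=
      finsupp_hom_ext fun k ↦ by rw [← Category.assoc, finsuppι_desc, hb]
    rw [← Abelian.Ext.mk₀_homEquiv₀_apply y, ← hy, ← Abelian.Ext.mk₀_comp_mk₀_assoc,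
      hS.comp_extClass, Abelian.Ext.comp_zero]
  | succ m hm =>
    have := hm S.X₃ (.X₃ hS (hX.mono (Nat.zero_le 1)) (extVanishAbove_zero_of_injective _ _))
    rw [Subsingleton.elim y 0, Abelian.Ext.zero_comp]

lemma HomAcyclic.finsupp (κ : Type u) {Y : CochainComplex (ModuleCat.{u} R) ℤ}
    (h : HomAcyclic.{u} (ModuleCat.of R T) Y) :
    HomAcyclic.{u} (ModuleCat.of R (κ →₀ T)) Y where
  extVanishAbove k := (h.extVanishAbove k).finsupp κ
  homExactAt j a ha := by
    choose b hb using fun k : κ ↦ h.homExactAt j (finsuppι k ≫ a) (by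
      rw [Category.assoc, ha, comp_zero])
    exact ⟨finsuppDesc b, finsupp_hom_ext fun k ↦ by rw [← Category.assoc, finsuppι_desc, hb]⟩

lemma HomAcyclic.of_memAddT {M : ModuleCat.{u} R} {Y : CochainComplex (ModuleCat.{u} R) ℤ}
    (hM : MemAddT R T M) (h : HomAcyclic.{u} (ModuleCat.of R T) Y) : HomAcyclic.{u} M Y := by
  obtain ⟨κ, s, p, hsp⟩ := hM
  exact .of_retract (s := ModuleCat.ofHom s) (p := ModuleCat.ofHom p) (ModuleCat.hom_ext hsp)
    (h.finsupp κ)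

variable {n : ℕ}

lemma IsNTilting.acyclic_of_homAcyclic (hT : IsNTilting R n T)
    {Y : CochainComplex (ModuleCat.{u} R) ℤ} (h : HomAcyclic.{u} (ModuleCat.of R T) Y) :
    Y.Acyclic := by
  obtain ⟨-, -, U, ε, d, hU, hε, hεd, hd, r, hr⟩ := hT
  have comp_d (i : ℕ) : d i ≫ d (i + 1) = 0 := by
    ext x
    exact (hd i).apply_apply_eq_zero x
  have hS (i : ℕ) := shortExact_kernel_of_exact (S := .mk (d i) (d (i + 1)) (comp_d i))
    ((ShortComplex.ShortExact.moduleCat_exact_iff_function_exact _).2 (hd i))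
  have hK (k i : ℕ) (hi : r < i + k) : HomAcyclic.{u} (kernel (d i)) Y := by
    induction k generalizing i with
    | zero =>
      have := hr i hi
      exact .of_isZero (.of_mono (kernel.ι (d i)) (ModuleCat.isZero_of_subsingleton _))
    | succ k hk => exact .X₁ (hS i) (.of_memAddT (hU i) h) (hk (i + 1) (by lia))
  have hεd' : ε ≫ d 0 = 0 :=
    ModuleCat.hom_ext (LinearMap.ext fun x ↦ hεd.apply_apply_eq_zero x)
  have hE : (ShortComplex.mk ε (d 0) hεd').Exact :=
    (ShortComplex.ShortExact.moduleCat_exact_iff_function_exact _).2 hεd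
  have : Mono ε := (ModuleCat.mono_iff_injective ε).2 hε
  have := hE.epi_kernelLift
  have : Mono (kernel.lift (d 0) ε hεd') := mono_of_mono_fac (kernel.lift_ι (d 0) ε hεd')
  have : IsIso (kernel.lift (d 0) ε hεd') := isIso_of_mono_of_epi _
  exact acyclic_of_homExactAt (HomAcyclic.of_retract (IsIso.hom_inv_id (kernel.lift (d 0) ε hεd'))
    (hK (r + 1) 0 (by lia))).homExactAt

end Tilting

/-- For an `n`-tilting module `T` with induced `t`-structure `(U, V)` on `D(R)`, a complex
`X` belongs to `U` if and only if `X` is isomorphic in `D(R)` to a complex concentrated in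
degrees `≤ 0` with all terms in `Add T`. -/
theorem stmt11 (R : Type u) [Ring R] [HasDerivedCategory.{w} (ModuleCat.{u} R)]
    (n : ℕ) (T : Type u) [AddCommGroup T] [Module R T] (hT : IsNTilting R n T)
    (X : DerivedCategory (ModuleCat.{u} R)) :
    X ∈ aisleSet R T ↔
      ∃ Z : CochainComplex (ModuleCat.{u} R) ℤ,
        (∀ i : ℤ, 0 < i → Limits.IsZero (Z.X i)) ∧
        (∀ i : ℤ, MemAddT R T (Z.X i)) ∧
        Nonempty (DerivedCategory.Q.obj Z ≅ X) := by
  constructor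
  · intro hX
    obtain ⟨Y, s, hs, hY⟩ := exists_quasiIso_extVanishAbove (DerivedCategory.Q.objPreimage X)
      fun k ↦ hT.extVanishAbove _
    let e : X ≅ DerivedCategory.Q.obj Y :=
      (DerivedCategory.Q.objObjPreimageIso X).symm ≪≫ asIso (DerivedCategory.Q.map s)
    obtain ⟨Z, φ, hZ, hZ', hφ⟩ := exists_homQuasiIso_memAddT T Y
      ((hT.Q_mem_aisleSet_iff hY).1 (mem_aisleSet_of_iso e hX))
    have hC : HomAcyclic.{u} (ModuleCat.of R T) (CochainComplex.mappingCone φ) :=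
      ⟨.mappingCone φ (fun k ↦ hT.extVanishAbove_of_memAddT (hZ' k)) hY, homExactAt_mappingCone hφ⟩
    have := (acyclic_mappingCone_iff φ).1 (hT.acyclic_of_homAcyclic hC)
    exact ⟨Z, hZ, hZ', ⟨asIso (DerivedCategory.Q.map φ) ≪≫ e.symm⟩⟩
  · rintro ⟨Z, hZ, hZ', ⟨e⟩⟩
    exact mem_aisleSet_of_iso e
      ((hT.Q_mem_aisleSet_iff fun k ↦ hT.extVanishAbove_of_memAddT (hZ' k)).2
        fun j hj a _ ↦ ⟨0, (hZ j hj).eq_of_tgt _ _⟩)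

end
end
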